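/- arXiv:1507.00173 — 7 statements merged into one kernel-verified Lean document; each statement's English description precedes it below -/
import Mathlib

section
/- If a finite simple t-imperfect graph G contains a harmonious cutset, then G has a proper induced subgraph that is t-imperfect. In particular, no minimally t-imperfect graph admits a harmonious cutset. -/
open Finset SimpleGraph

/-- A set of vertices is stable (independent) if no two of its vertices are adjacent. -/
def IsStable {V : Type} (G : SimpleGraph V) (S : Set V) : Prop :=
  ∀ ⦃u⦄, u ∈ S → ∀ ⦃v⦄, v ∈ S → ¬ G.Adj u v

/-- The characteristic vector of a set of vertices. -/
noncomputable def charVec {V : Type} (S : Set V) : V → ℝ :=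
  S.indicator 1

/-- The stable set polytope: the convex hull of characteristic vectors of stable sets. -/
noncomputable def SSP {V : Type} (G : SimpleGraph V) : Set (V → ℝ) :=
  convexHull ℝ (charVec '' {S : Set V | IsStable G S})

/-- `C` is the vertex set of an induced cycle of `G`. -/
def IsInducedCycle {V : Type} (G : SimpleGraph V) (C : Finset V) : Prop :=
  3 ≤ C.card ∧ Nonempty (cycleGraph C.card ≃g G.induce (C : Set V))

/-- The polytope given by non-negativity, edge and odd-cycle constraints. -/
def TSTAB {V : Type} (G : SimpleGraph V) : Set (V → ℝ) :=
  {x | (∀ v, 0 ≤ x v) ∧ (∀ u v, G.Adj u v → x u + x v ≤ 1) ∧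
    ∀ C : Finset V, IsInducedCycle G C → Odd C.card →
      ∑ v ∈ C, x v ≤ ((C.card / 2 : ℕ) : ℝ)}

/-- A graph is t-perfect if its stable set polytope coincides with `TSTAB`. -/
def TPerfect {V : Type} (G : SimpleGraph V) : Prop :=
  SSP G = TSTAB G

/-- `G` contains `H` as an induced subgraph. -/
def HasInducedSubgraph {V W : Type} (G : SimpleGraph V) (H : SimpleGraph W) : Prop :=
  Nonempty (H ↪g G)

/-- A graph is P5-free if it contains no induced path on five vertices. -/
def P5Free {V : Type} (G : SimpleGraph V) : Prop :=
  ¬ HasInducedSubgraph G (pathGraph 5)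

/-- circular distance: min(|i-j|, n-|i-j|). -/
def circDist (n : ℕ) (i j : Fin n) : ℕ :=
  min ((i.val + n - j.val) % n) ((j.val + n - i.val) % n)

/-- The k-th power of the n-cycle: distinct i,j adjacent iff circular distance ≤ k. -/
def cyclePower (n k : ℕ) : SimpleGraph (Fin n) :=
  SimpleGraph.fromRel (fun i j => circDist n i j ≤ k)

/-- The antiweb: distinct i,j adjacent iff circular distance > k. -/
def antiweb (n k : ℕ) : SimpleGraph (Fin n) :=
  SimpleGraph.fromRel (fun i j => k < circDist n i j)

/-- The wheel W_n: the cycle C_n together with a hub adjacent to all cycle vertices. -/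
def wheel (n : ℕ) : SimpleGraph (Fin (n + 1)) :=
  SimpleGraph.fromRel (fun i j =>
    (i.val < n ∧ j.val < n ∧ (i.val + 1) % n = j.val) ∨ i.val = n ∨ j.val = n)

/-- The graph obtained from `G` by simultaneously contracting all edges incident
with the vertex `v`: the vertices of the neighbourhood of `v` get merged into `v`. -/
def tContract {V : Type} (G : SimpleGraph V) (v : V) :
    SimpleGraph {u : V // u ∉ G.neighborSet v} :=
  SimpleGraph.fromRel (fun a b =>
    (a.val = v ∧ ∃ w, (w = v ∨ G.Adj v w) ∧ G.Adj w b.val) ∨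
    (a.val ≠ v ∧ G.Adj a.val b.val))

/-- `IsTMinor H G`: `H` is (isomorphic to) a t-minor of `G`, i.e. obtainable from `G`
by a sequence of vertex deletions and of t-contractions at vertices with stable
neighbourhood. -/
inductive IsTMinor : {W : Type} → SimpleGraph W → {V : Type} → SimpleGraph V → Prop
  | of_iso {W V : Type} {H : SimpleGraph W} {G : SimpleGraph V} (e : H ≃g G) : IsTMinor H G
  | delete {W V : Type} {H : SimpleGraph W} {G : SimpleGraph V} (v : V)
      (h : IsTMinor H (G.induce {u | u ≠ v})) : IsTMinor H G
  | contract {W V : Type} {H : SimpleGraph W} {G : SimpleGraph V} (v : V)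
      (hst : IsStable G (G.neighborSet v))
      (h : IsTMinor H (tContract G v)) : IsTMinor H G

/-- An induced path in `G`. -/
def IsInducedPath {V : Type} (G : SimpleGraph V) {u v : V} (p : G.Walk u v) : Prop :=
  p.IsPath ∧ p.toSubgraph.IsInduced

/-- A tuple `(X 0, …, X (s-1))` of disjoint vertex sets is `G`-harmonious if every
induced path with one endvertex in `X i` and the other in `X j` has even length iff
`i = j`, and, when `s ≥ 3`, the parts are pairwise complete to each other. -/
def Harmonious {V : Type} (G : SimpleGraph V) {s : ℕ} (X : Fin s → Set V) : Prop :=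
  (∀ i j, i ≠ j → Disjoint (X i) (X j)) ∧
  (∀ i j (u v : V) (p : G.Walk u v), u ∈ X i → v ∈ X j → IsInducedPath G p →
      (Even p.length ↔ i = j)) ∧
  (3 ≤ s → ∀ i j, i ≠ j → ∀ u ∈ X i, ∀ v ∈ X j, G.Adj u v)

/-- `X` is a harmonious cutset of `G`. -/
def IsHarmoniousCutset {V : Type} (G : SimpleGraph V) (X : Set V) : Prop :=
  (∃ V1 V2 : Set V, V1 ∪ V2 = Set.univ ∧ (V1 \ V2).Nonempty ∧ (V2 \ V1).Nonempty ∧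
    (∀ u ∈ V1 \ V2, ∀ v ∈ V2 \ V1, ¬ G.Adj u v) ∧ X = V1 ∩ V2) ∧
  (∃ (s : ℕ) (Xp : Fin s → Set V), (⋃ i, Xp i) = X ∧ Harmonious G Xp)

/-- A 5-cycle `c1 c2 c3 c4 c5` (vertices `0,…,4`) plus a vertex adjacent exactly to
`c1, c2, c3`. -/
def graphA : SimpleGraph (Fin 6) :=
  SimpleGraph.fromRel (fun i j =>
    (i.val < 5 ∧ j.val < 5 ∧ (i.val + 1) % 5 = j.val) ∨ (i = 5 ∧ (j = 0 ∨ j = 1 ∨ j = 2)))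

/-- A 5-cycle `c1 c2 c3 c4 c5` (vertices `0,…,4`) plus a vertex adjacent exactly to
`c1, c2, c3, c4`. -/
def graphB : SimpleGraph (Fin 6) :=
  SimpleGraph.fromRel (fun i j =>
    (i.val < 5 ∧ j.val < 5 ∧ (i.val + 1) % 5 = j.val) ∨
    (i = 5 ∧ (j = 0 ∨ j = 1 ∨ j = 2 ∨ j = 3)))

/-- A 5-cycle `v0 v1 v2 v3 v4` (vertices `0,…,4`) plus vertices `u = 5`, `v = 6`, `x = 7`,
where `u` is adjacent exactly to `v0, v1, v3, x`, `v` is adjacent exactly to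
`v1, v3, v4, x`, and `x` is adjacent exactly to `u, v`. -/
def graphC : SimpleGraph (Fin 8) :=
  SimpleGraph.fromRel (fun i j =>
    (i.val < 5 ∧ j.val < 5 ∧ (i.val + 1) % 5 = j.val) ∨
    (i = 5 ∧ (j = 0 ∨ j = 1 ∨ j = 3 ∨ j = 7)) ∨
    (i = 6 ∧ (j = 1 ∨ j = 3 ∨ j = 4 ∨ j = 7)))

/-- `G` contains none of the nine graphs of the family 𝓕 as an induced subgraph. -/
def FFree {V : Type} (G : SimpleGraph V) : Prop :=
  ¬ HasInducedSubgraph G (pathGraph 5) ∧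
  ¬ HasInducedSubgraph G (completeGraph (Fin 4)) ∧
  ¬ HasInducedSubgraph G (wheel 5) ∧
  ¬ HasInducedSubgraph G (cyclePower 7 2) ∧
  ¬ HasInducedSubgraph G (antiweb 10 2) ∧
  ¬ HasInducedSubgraph G (antiweb 13 3) ∧
  ¬ HasInducedSubgraph G graphA ∧
  ¬ HasInducedSubgraph G graphB ∧
  ¬ HasInducedSubgraph G graphC

/-- `c` enumerates an induced 5-cycle (a 5-hole) of `G`. -/
def IsFiveHole {V : Type} (G : SimpleGraph V) (c : ZMod 5 → V) : Prop :=
  Function.Injective c ∧ ∀ i j, G.Adj (c i) (c j) ↔ (j = i + 1 ∨ i = j + 1)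

/-- A graph is near-bipartite if deleting the neighbourhood of any vertex leaves a
bipartite graph. -/
def NearBipartite {V : Type} (G : SimpleGraph V) : Prop :=
  ∀ v : V, (G.induce {u | u ∉ G.neighborSet v}).Colorable 2

section Geometry

/-- A point of the convex hull of a finite family is a convex combination whose weights minimise
the total cost; no exchange between two indices of positive weight can decrease the cost. -/
theorem exists_convex_combination_cost_minimal {ι E : Type*} [Fintype ι] [AddCommGroup E]
    [Module ℝ E] [TopologicalSpace E] [IsTopologicalAddGroup E] [ContinuousSMul ℝ E] [T2Space E]
    (f : ι → E) (c : ι → ℝ) {z : E} (hz : z ∈ convexHull ℝ (Set.range f)) :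
    ∃ w ∈ stdSimplex ℝ ι, ∑ i, w i • f i = z ∧
      ∀ i j k l, i ≠ j → 0 < w i → 0 < w j → f i + f j = f k + f l →
        c i + c j ≤ c k + c l := by
  classical
  set K : Set (ι → ℝ) := stdSimplex ℝ ι ∩ {w | ∑ i, w i • f i = z} with hK
  have hKc : IsCompact K := (isCompact_stdSimplex ℝ ι).inter_right
    (isClosed_eq (by fun_prop) continuous_const)
  have hKn : K.Nonempty := by
    have h : convexHull ℝ (Set.range f) =
        Fintype.linearCombination ℝ f '' stdSimplex ℝ ι := by
      rw [← convexHull_basis_eq_stdSimplex, LinearMap.image_convexHull, ← Set.range_comp]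
      congr 1
      ext x
      simp [Fintype.linearCombination_apply]
    rw [h] at hz
    obtain ⟨w, hw, rfl⟩ := hz
    exact ⟨w, hw, by simp [Fintype.linearCombination_apply]⟩
  obtain ⟨w, hwK, hmin⟩ := hKc.exists_isMinOn hKn
    (f := fun w => ∑ i, w i * c i) (by fun_prop)
  refine ⟨w, hwK.1, hwK.2, fun i j k l hij hi hj hf => ?_⟩
  by_contra! hlt
  set ε := min (w i) (w j) with hε
  have hεpos : 0 < ε := lt_min hi hj
  let δ : ι → ι → ℝ := fun a => Pi.single a 1
  set w' : ι → ℝ := fun m => w m + ε * (δ k m + δ l m - δ i m - δ j m) with hw'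
  have hsum : ∑ m, w' m = 1 := by
    have := hwK.1.2
    simp [hw', δ, Finset.sum_add_distrib, ← Finset.mul_sum, this]
  have hfsum : ∑ m, w' m • f m = z := by
    have h2 : ∑ m, w m • f m = z := hwK.2
    simp only [hw', add_smul, mul_smul, sub_smul, Finset.sum_add_distrib, ← Finset.smul_sum,
      Finset.sum_sub_distrib, h2]
    simp [δ, Pi.single_apply, ← hf]
  have hcsum : ∑ m, w' m * c m = ∑ m, w m * c m + ε * (c k + c l - c i - c j) := by
    simp only [hw', add_mul, mul_assoc, sub_mul, Finset.sum_add_distrib, ← Finset.mul_sum,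
      Finset.sum_sub_distrib]
    simp [δ, Pi.single_apply]
  have hnn : ∀ m, 0 ≤ w' m := by
    intro m
    have h1 := hwK.1.1 m
    have h2 : ε ≤ w i := min_le_left _ _
    have h3 : ε ≤ w j := min_le_right _ _
    simp only [hw', δ, Pi.single_apply]
    split_ifs <;> subst_vars <;> first | (exact absurd rfl hij) | nlinarith
  have := isMinOn_iff.1 hmin w' ⟨⟨hnn, hsum⟩, hfsum⟩
  simp only [hcsum] at this
  nlinarith

end Geometry

section Paths

variable {V : Type} {G : SimpleGraph V}

/-- If two vertices are joined by a walk inside `D`, they are joined by an induced path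
inside `D`. -/
theorem exists_isInducedPath_of_walk {D : Set V} {u v : V} (p : G.Walk u v)
    (hp : ∀ w ∈ p.support, w ∈ D) :
    ∃ q : G.Walk u v, IsInducedPath G q ∧ ∀ w ∈ q.support, w ∈ D := by
  classical
  have hex : ∃ n, ∃ q : G.Walk u v, (∀ w ∈ q.support, w ∈ D) ∧ q.length = n := ⟨_, p, hp, rfl⟩
  obtain ⟨q₀, hq₀D, hq₀⟩ := Nat.find_spec hex
  have hmin : ∀ q : G.Walk u v, (∀ w ∈ q.support, w ∈ D) → Nat.find hex ≤ q.length :=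
    fun q hq => Nat.find_min' hex ⟨q, hq, rfl⟩
  obtain ⟨q, hqp, hqD, hqn⟩ : ∃ q : G.Walk u v, q.IsPath ∧ (∀ w ∈ q.support, w ∈ D) ∧
      q.length = Nat.find hex := by
    have hD : ∀ w ∈ q₀.bypass.support, w ∈ D :=
      fun w hw => hq₀D w (q₀.support_bypass_subset_support hw)
    exact ⟨q₀.bypass, q₀.bypass_isPath, hD,
      le_antisymm (hq₀ ▸ q₀.length_bypass_le_length) (hmin _ hD)⟩
  have key : ∀ i j, i < j → j ≤ q.length → G.Adj (q.getVert i) (q.getVert j) → j = i + 1 := by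
    intro i j hij hj hadj
    have := hmin ((q.take i).append (Walk.cons hadj (q.drop j))) (by
      intro w hw
      rw [Walk.mem_support_append_iff, Walk.support_cons, List.mem_cons] at hw
      rcases hw with hw | rfl | hw
      · exact hqD w ((q.isSubwalk_take i).support_subset hw)
      · exact hqD _ (q.getVert_mem_support i)
      · exact hqD w ((q.isSubwalk_drop j).support_subset hw))
    simp only [Walk.length_append, Walk.length_cons, Walk.take_length, Walk.drop_length] at this
    omega
  refine ⟨q, ⟨hqp, ?_⟩, hqD⟩
  intro a ha b hb hab
  rw [Walk.mem_verts_toSubgraph, Walk.mem_support_iff_exists_getVert] at ha hb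
  obtain ⟨i, rfl, hi⟩ := ha
  obtain ⟨j, rfl, hj⟩ := hb
  rcases lt_trichotomy i j with h | h | h
  · obtain rfl := key i j h hj hab
    exact q.toSubgraph_adj_getVert (by omega)
  · subst h
    exact absurd hab (G.loopless.irrefl _)
  · obtain rfl := key j i h hi hab.symm
    exact (q.toSubgraph_adj_getVert (by omega)).symm

/-- A walk in the symmetric difference of two stable sets alternates between them. -/
theorem even_length_iff_of_support_subset_symmDiff {S T : Set V} (hS : IsStable G S)
    (hT : IsStable G T) {u v : V} (p : G.Walk u v) (hp : ∀ w ∈ p.support, w ∈ symmDiff S T) :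
    Even p.length ↔ (u ∈ S ↔ v ∈ S) := by
  induction p with
  | nil => simp
  | @cons a b c h p ih =>
    have ih' := ih fun w hw => hp w (by simp [hw])
    have ha := hp a (by simp)
    have hb := hp b (by simp)
    rw [Set.mem_symmDiff] at ha hb
    have h1 : a ∈ S → b ∉ S := fun x y => hS x y h
    have h2 : a ∈ T → b ∉ T := fun x y => hT x y h
    rw [Walk.length_cons, Nat.even_add_one, ih']
    tauto

/-- Uncrossing of two stable sets along components of their symmetric difference. -/
theorem exists_uncrossing {A B S T : Set V} (hS : IsStable G S) (hT : IsStable G T)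
    (hAA : ∀ (u v : V) (p : G.Walk u v), u ∈ A → v ∈ A → IsInducedPath G p → Even p.length)
    (hAB : ∀ (u v : V) (p : G.Walk u v), u ∈ A → v ∈ B → IsInducedPath G p → ¬ Even p.length)
    (hBA : ∀ (u v : V) (p : G.Walk u v), u ∈ B → v ∈ A → IsInducedPath G p → ¬ Even p.length)
    (hBB : (∀ (u v : V) (p : G.Walk u v), u ∈ B → v ∈ B → IsInducedPath G p → Even p.length) ∨
      ∀ v ∈ S, v ∉ B) :
    ∃ S' T' : Set V, IsStable G S' ∧ IsStable G T' ∧ S' ⊆ S ∪ T ∧ T' ⊆ S ∪ T ∧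
      charVec S + charVec T = charVec S' + charVec T' ∧
      (∀ v ∈ A, (v ∈ S' ↔ v ∈ S ∨ v ∈ T) ∧ (v ∈ T' ↔ v ∈ S ∧ v ∈ T)) ∧
      (∀ v ∈ B, (v ∈ S' ↔ v ∈ S ∧ v ∈ T) ∧ (v ∈ T' ↔ v ∈ S ∨ v ∈ T)) := by
  set D := symmDiff S T with hD
  set Z : Set V := (A ∩ (T \ S)) ∪ (B ∩ (S \ T)) with hZ
  set K : Set V := {v | ∃ u ∈ Z, ∃ p : G.Walk u v, ∀ w ∈ p.support, w ∈ D} with hK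
  have hKD : ∀ v ∈ K, v ∈ D := fun v ⟨u, _, p, hp⟩ => hp v p.end_mem_support
  have hZK : ∀ v ∈ Z, v ∈ K := fun v hv => ⟨v, hv, Walk.nil, by
    simp only [Walk.support_nil, List.mem_singleton, forall_eq, hD, Set.mem_symmDiff]
    rcases hv with h | h
    · exact Or.inr h.2
    · exact Or.inl h.2⟩
  have hstep : ∀ u ∈ K, ∀ v ∈ D, G.Adj u v → v ∈ K := by
    rintro u ⟨a, ha, p, hp⟩ v hv huv
    refine ⟨a, ha, p.concat huv, fun w hw => ?_⟩
    rw [Walk.support_concat, List.mem_append, List.mem_singleton] at hw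
    rcases hw with hw | rfl
    · exact hp w hw
    · exact hv
  have hpar : ∀ v ∈ K, ∃ u ∈ Z, ∃ p : G.Walk u v, IsInducedPath G p ∧
      (Even p.length ↔ (u ∈ S ↔ v ∈ S)) := by
    rintro v ⟨u, hu, p, hp⟩
    obtain ⟨q, hq, hqD⟩ := exists_isInducedPath_of_walk p hp
    exact ⟨u, hu, q, hq, even_length_iff_of_support_subset_symmDiff hS hT q hqD⟩
  have hAgood : ∀ v ∈ A, v ∈ S → v ∉ T → v ∉ K := by
    intro v hvA hvS hvT hvK
    obtain ⟨u, hu, p, hp, he⟩ := hpar v hvK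
    rcases hu with ⟨huA, huT, huS⟩ | ⟨huB, huS, huT⟩
    · have := hAA u v p huA hvA hp
      tauto
    · have := hBA u v p huB hvA hp
      tauto
  have hBgood : ∀ v ∈ B, v ∈ T → v ∉ S → v ∉ K := by
    intro v hvB hvT hvS hvK
    obtain ⟨u, hu, p, hp, he⟩ := hpar v hvK
    rcases hu with ⟨huA, huT, huS⟩ | ⟨huB, huS, huT⟩
    · have := hAB u v p huA hvB hp
      tauto
    · rcases hBB with hBB | hBB
      · have := hBB u v p huB hvB hp
        tauto
      · exact hBB u huS huB
  have hZA : ∀ v ∈ A, v ∈ T → v ∉ S → v ∈ K := fun v h1 h2 h3 => hZK v (Or.inl ⟨h1, h2, h3⟩)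
  have hZB : ∀ v ∈ B, v ∈ S → v ∉ T → v ∈ K := fun v h1 h2 h3 => hZK v (Or.inr ⟨h1, h2, h3⟩)
  have hKD' : ∀ v ∈ K, (v ∈ S ∧ v ∉ T) ∨ (v ∈ T ∧ v ∉ S) := fun v hv => hKD v hv
  have hflip : ∀ {P Q : Set V}, IsStable G P → IsStable G Q → (∀ v, v ∈ P → v ∉ Q → v ∈ D) →
      ∀ u v, u ∈ P → u ∉ K → v ∈ Q → v ∈ K → ¬ G.Adj u v := by
    intro P Q hP hQ hPQ u v huP huK hvQ hvK huv
    by_cases huQ : u ∈ Q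
    · exact hQ huQ hvQ huv
    · exact huK (hstep v hvK u (hPQ u huP huQ) huv.symm)
  have hST := hflip hS hT fun v h1 h2 => Or.inl ⟨h1, h2⟩
  have hTS := hflip hT hS fun v h1 h2 => Or.inr ⟨h1, h2⟩
  refine ⟨(S \ K) ∪ (T ∩ K), (T \ K) ∪ (S ∩ K), ?_, ?_, ?_, ?_, ?_, ?_, ?_⟩
  · rintro u (⟨hu, huK⟩ | ⟨hu, huK⟩) v (⟨hv, hvK⟩ | ⟨hv, hvK⟩) h
    · exact hS hu hv h
    · exact hST u v hu huK hv hvK h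
    · exact hST v u hv hvK hu huK h.symm
    · exact hT hu hv h
  · rintro u (⟨hu, huK⟩ | ⟨hu, huK⟩) v (⟨hv, hvK⟩ | ⟨hv, hvK⟩) h
    · exact hT hu hv h
    · exact hTS u v hu huK hv hvK h
    · exact hTS v u hv hvK hu huK h.symm
    · exact hS hu hv h
  · rintro v (h | h)
    exacts [Or.inl h.1, Or.inr h.1]
  · rintro v (h | h)
    exacts [Or.inr h.1, Or.inl h.1]
  · ext v
    by_cases hvK : v ∈ K <;> by_cases hvS : v ∈ S <;> by_cases hvT : v ∈ T <;>
      simp [charVec, hvK, hvS, hvT]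
  · intro v hv
    have := hAgood v hv
    have := hZA v hv
    have := hKD' v
    simp only [Set.mem_union, Set.mem_sdiff, Set.mem_inter_iff]
    tauto
  · intro v hv
    have := hBgood v hv
    have := hZB v hv
    have := hKD' v
    simp only [Set.mem_union, Set.mem_sdiff, Set.mem_inter_iff]
    tauto

end Paths

section Polytopes

variable {V : Type}

theorem convex_TSTAB (G : SimpleGraph V) : Convex ℝ (TSTAB G) := by
  rintro x ⟨hx1, hx2, hx3⟩ y ⟨hy1, hy2, hy3⟩ a b ha hb hab
  refine ⟨fun v => ?_, fun u v h => ?_, fun C hC ho => ?_⟩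
  · exact add_nonneg (mul_nonneg ha (hx1 v)) (mul_nonneg hb (hy1 v))
  · have h1 := mul_le_mul_of_nonneg_left (hx2 u v h) ha
    have h2 := mul_le_mul_of_nonneg_left (hy2 u v h) hb
    simp only [Pi.add_apply, Pi.smul_apply, smul_eq_mul]
    linarith
  · have h1 := mul_le_mul_of_nonneg_left (hx3 C hC ho) ha
    have h2 := mul_le_mul_of_nonneg_left (hy3 C hC ho) hb
    simp only [Pi.add_apply, Pi.smul_apply, smul_eq_mul, Finset.sum_add_distrib, ← Finset.mul_sum]
    calc _ ≤ a * ((C.card / 2 : ℕ) : ℝ) + b * ((C.card / 2 : ℕ) : ℝ) := add_le_add h1 h2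
      _ = _ := by rw [← add_mul, hab, one_mul]

theorem sum_charVec_le_of_isInducedCycle {G : SimpleGraph V} {S : Set V} (hS : IsStable G S)
    {C : Finset V} (hC : IsInducedCycle G C) :
    ∑ v ∈ C, charVec S v ≤ ((C.card / 2 : ℕ) : ℝ) := by
  classical
  obtain ⟨h3, ⟨e⟩⟩ := hC
  obtain ⟨n, hn⟩ : ∃ n, C.card = n + 2 := ⟨C.card - 2, by omega⟩
  generalize C.card = m at e hn
  subst hn
  have hsum : ∑ v ∈ C, charVec S v = ((univ.filter fun i => (e i : V) ∈ S).card : ℝ) := by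
    rw [← Finset.sum_coe_sort C, Finset.card_filter]
    push_cast
    refine (Fintype.sum_equiv e.toEquiv _ _ fun i => ?_).symm
    simp only [charVec, Set.indicator_apply, Pi.one_apply]
    rfl
  rw [hsum]
  norm_cast
  set P := univ.filter fun i => (e i : V) ∈ S with hP
  have hdisj : Disjoint P (P.map (Equiv.addRight (1 : Fin (n + 2))).toEmbedding) := by
    rw [Finset.disjoint_left]
    intro i hi hi'
    simp only [hP, Finset.mem_map, mem_filter, Finset.mem_univ, true_and] at hi hi'
    obtain ⟨j, hj, rfl⟩ := hi'
    have hadj : (cycleGraph (n + 2)).Adj j (j + 1) := by simp [cycleGraph_adj]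
    exact hS hj hi (e.map_rel_iff.2 hadj)
  have := Finset.card_union_of_disjoint hdisj
  have h2 := Finset.card_le_univ (P ∪ P.map (Equiv.addRight (1 : Fin (n + 2))).toEmbedding)
  rw [this, Finset.card_map, Fintype.card_fin] at h2
  omega

theorem SSP_subset_TSTAB (G : SimpleGraph V) : SSP G ⊆ TSTAB G := by
  refine convexHull_min ?_ (convex_TSTAB G)
  rintro _ ⟨S, hS, rfl⟩
  refine ⟨fun v => ?_, fun u v h => ?_, fun C hC _ => sum_charVec_le_of_isInducedCycle hS hC⟩
  · exact Set.indicator_nonneg (fun _ _ => zero_le_one) v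
  · have : ¬ (u ∈ S ∧ v ∈ S) := fun hh => hS hh.1 hh.2 h
    by_cases hu : u ∈ S <;> by_cases hv : v ∈ S <;> simp_all [charVec]

theorem comp_val_mem_TSTAB_induce {G : SimpleGraph V} {z : V → ℝ} (hz : z ∈ TSTAB G)
    (U : Set V) : (fun u : U => z u) ∈ TSTAB (G.induce U) := by
  refine ⟨fun v => hz.1 v, fun u v h => hz.2.1 u v h, fun C hC ho => ?_⟩
  have h := hz.2.2 (C.map (Function.Embedding.subtype _)) ?_ (by simpa using ho)
  · simpa using h
  obtain ⟨h3, ⟨e⟩⟩ := hC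
  refine ⟨by simpa using h3, ?_⟩
  rw [Finset.card_map]
  refine ⟨e.trans ⟨⟨fun v => ⟨v.1.1, by simp⟩,
    fun v => ⟨⟨v.1, ?_⟩, ?_⟩, fun _ => rfl, fun _ => rfl⟩, Iff.rfl⟩⟩
  · have := v.2
    simp only [coe_map, Function.Embedding.subtype_apply, Set.mem_image, mem_coe] at this
    obtain ⟨x, -, hx⟩ := this
    exact hx ▸ x.2
  · have := v.2
    simp only [coe_map, Function.Embedding.subtype_apply, Set.mem_image, mem_coe] at this
    obtain ⟨x, hx, hx'⟩ := this
    have : x = ⟨v.1, hx' ▸ x.2⟩ := Subtype.ext hx'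
    exact this ▸ hx

/-- A point of `TSTAB G` restricted to a t-perfect part `U` is a convex combination of stable
sets contained in `U`. -/
theorem indicator_mem_convexHull_of_tPerfect_induce {G : SimpleGraph V} {z : V → ℝ}
    (hz : z ∈ TSTAB G) {U : Set V} (hU : TPerfect (G.induce U)) :
    U.indicator z ∈ convexHull ℝ (charVec '' {S : Set V | S ⊆ U ∧ IsStable G S}) := by
  classical
  have h := comp_val_mem_TSTAB_induce hz U
  rw [← hU, SSP] at h
  have h' := Set.mem_image_of_mem (Function.ExtendByZero.linearMap ℝ (Subtype.val : U → V)) h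
  rw [LinearMap.image_convexHull, Set.image_image] at h'
  have hext : ∀ x : U → ℝ, ∀ v, Function.ExtendByZero.linearMap ℝ (Subtype.val : U → V) x v =
      if hv : v ∈ U then x ⟨v, hv⟩ else 0 := by
    intro x v
    by_cases hv : v ∈ U
    · have := Subtype.val_injective.extend_apply x (0 : V → ℝ) ⟨v, hv⟩
      simpa [hv] using this
    · have : ¬ ∃ a : U, a.1 = v := by rintro ⟨a, rfl⟩; exact hv a.2
      simp [hv]
  have hz' : Function.ExtendByZero.linearMap ℝ (Subtype.val : U → V) (fun u : U => z u) =
      U.indicator z := by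
    ext v
    rw [hext, Set.indicator_apply]
    simp
  rw [hz'] at h'
  refine convexHull_mono ?_ h'
  rintro _ ⟨S, hS, rfl⟩
  refine ⟨Subtype.val '' S, ⟨by simp, ?_⟩, ?_⟩
  · rintro _ ⟨a, ha, rfl⟩ _ ⟨b, hb, rfl⟩ hab
    exact hS ha hb hab
  · ext v
    beta_reduce
    rw [hext]
    by_cases hv : v ∈ U <;> simp [charVec, Set.indicator_apply, hv]

end Polytopes

section Gluing

variable {V : Type} {G : SimpleGraph V}

/-- The number of vertices of `X` lying in exactly one of `S` and `T`. -/
noncomputable def traceMismatch [Fintype V] (X S T : Set V) : ℝ :=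
  ∑ v, X.indicator (fun v => |charVec S v - charVec T v|) v

/-- If the vertex `x` of a harmonious set lies in `S` but not in `T`, and in `T'` but not in `S'`,
then uncrossing `S` with `S'` and `T` with `T'` makes the traces agree better. -/
theorem Harmonious.exists_exchange [Fintype V] {s : ℕ} {X : Fin s → Set V}
    (h : Harmonious G X) {S S' T T' : Set V} (hS : IsStable G S) (hS' : IsStable G S')
    (hT : IsStable G T) (hT' : IsStable G T') {i : Fin s} {x : V} (hx : x ∈ X i)
    (hxS : x ∈ S) (hxS' : x ∉ S') (hxT : x ∉ T) (hxT' : x ∈ T') :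
    ∃ P P' Q Q' : Set V, (IsStable G P ∧ IsStable G P' ∧ IsStable G Q ∧ IsStable G Q') ∧
      (P ⊆ S ∪ S' ∧ P' ⊆ S ∪ S' ∧ Q ⊆ T' ∪ T ∧ Q' ⊆ T' ∪ T) ∧
      charVec S + charVec S' = charVec P + charVec P' ∧
      charVec T + charVec T' = charVec Q + charVec Q' ∧
      traceMismatch (⋃ j, X j) P Q + traceMismatch (⋃ j, X j) P' Q' <
        traceMismatch (⋃ j, X j) S T + traceMismatch (⋃ j, X j) S' T' := by
  classical
  obtain ⟨hdisj, hpar, hcomp⟩ := h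
  set B : Set V := {v | ∃ j, j ≠ i ∧ v ∈ X j} with hB
  have hAA : ∀ (u v : V) (p : G.Walk u v), u ∈ X i → v ∈ X i → IsInducedPath G p →
      Even p.length := fun u v p hu hv hp => (hpar i i u v p hu hv hp).2 rfl
  have hAB : ∀ (u v : V) (p : G.Walk u v), u ∈ X i → v ∈ B → IsInducedPath G p →
      ¬ Even p.length := by
    rintro u v p hu ⟨j, hj, hv⟩ hp he
    exact hj ((hpar i j u v p hu hv hp).1 he).symm
  have hBA : ∀ (u v : V) (p : G.Walk u v), u ∈ B → v ∈ X i → IsInducedPath G p →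
      ¬ Even p.length := by
    rintro u v p ⟨j, hj, hu⟩ hv hp he
    exact hj ((hpar j i u v p hu hv hp).1 he)
  have hBB : ∀ {R : Set V}, IsStable G R → x ∈ R →
      (∀ (u v : V) (p : G.Walk u v), u ∈ B → v ∈ B → IsInducedPath G p → Even p.length) ∨
        ∀ v ∈ R, v ∉ B := by
    intro R hR hxR
    rcases Nat.lt_or_ge s 3 with hs | hs
    · left
      rintro u v p ⟨j, hj, hu⟩ ⟨k, hk, hv⟩ hp
      exact (hpar j k u v p hu hv hp).2 (by omega)
    · right
      rintro v hv ⟨j, hj, hvj⟩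
      exact hR hxR hv (hcomp hs i j hj.symm x hx v hvj)
  obtain ⟨P, P', hP, hP', hPs, hPs', hPsum, hPA, hPB⟩ :=
    exists_uncrossing hS hS' hAA hAB hBA (hBB hS hxS)
  obtain ⟨Q, Q', hQ, hQ', hQs, hQs', hQsum, hQA, hQB⟩ :=
    exists_uncrossing hT' hT hAA hAB hBA (hBB hT' hxT')
  refine ⟨P, P', Q, Q', ⟨hP, hP', hQ, hQ'⟩, ⟨hPs, hPs', hQs, hQs'⟩, hPsum,
    (add_comm _ _).trans hQsum, ?_⟩
  simp only [traceMismatch, ← Finset.sum_add_distrib]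
  refine Finset.sum_lt_sum (fun v _ => ?_) ⟨x, Finset.mem_univ x, ?_⟩
  · by_cases hv : v ∈ ⋃ j, X j
    · simp only [Set.indicator_of_mem hv]
      by_cases hvi : v ∈ X i
      · simp only [charVec, Set.indicator_apply, hPA v hvi, hQA v hvi]
        by_cases h1 : v ∈ S <;> by_cases h2 : v ∈ S' <;> by_cases h3 : v ∈ T <;>
          by_cases h4 : v ∈ T' <;> norm_num [h1, h2, h3, h4]
      · obtain ⟨j, hj⟩ := Set.mem_iUnion.1 hv
        have hvB : v ∈ B := ⟨j, fun hji => hvi (hji ▸ hj), hj⟩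
        simp only [charVec, Set.indicator_apply, hPB v hvB, hQB v hvB]
        by_cases h1 : v ∈ S <;> by_cases h2 : v ∈ S' <;> by_cases h3 : v ∈ T <;>
          by_cases h4 : v ∈ T' <;> norm_num [h1, h2, h3, h4]
    · simp [Set.indicator_of_notMem hv]
  · have hxX : x ∈ ⋃ j, X j := Set.mem_iUnion.2 ⟨i, hx⟩
    simp only [Set.indicator_of_mem hxX]
    simp only [charVec, Set.indicator_apply, hPA x hx, hQA x hx]
    norm_num [hxS, hxS', hxT, hxT']

/-- The restrictions of a point of `TSTAB G` to two t-perfect induced subgraphs are convex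
combinations of stable sets that can be coupled so that the traces on a harmonious set in the
intersection agree. -/
theorem Harmonious.exists_coupling [Fintype V] {V₁ V₂ : Set V} {s : ℕ} {X : Fin s → Set V}
    (h : Harmonious G X) (hX : ⋃ i, X i ⊆ V₁ ∩ V₂) (h₁ : TPerfect (G.induce V₁))
    (h₂ : TPerfect (G.induce V₂)) {z : V → ℝ} (hz : z ∈ TSTAB G) :
    ∃ (ι : Type) (_ : Fintype ι), ∃ w ∈ stdSimplex ℝ ι, ∃ S T : ι → Set V,
      (∀ p, S p ⊆ V₁ ∧ IsStable G (S p)) ∧ (∀ p, T p ⊆ V₂ ∧ IsStable G (T p)) ∧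
      (∀ v ∈ V₁, ∑ p, w p * charVec (S p) v = z v) ∧
      (∀ v ∈ V₂, ∑ p, w p * charVec (T p) v = z v) ∧
      ∀ p, 0 < w p → ∀ x ∈ ⋃ i, X i, (x ∈ S p ↔ x ∈ T p) := by
  classical
  let ι := {p : Set V × Set V // (p.1 ⊆ V₁ ∧ IsStable G p.1) ∧ (p.2 ⊆ V₂ ∧ IsStable G p.2)}
  let f : ι → (V → ℝ) × (V → ℝ) := fun p => (charVec p.1.1, charVec p.1.2)
  have hz' : (V₁.indicator z, V₂.indicator z) ∈ convexHull ℝ (Set.range f) := by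
    have hmem := mk_mem_convexHull_prod (indicator_mem_convexHull_of_tPerfect_induce hz h₁)
      (indicator_mem_convexHull_of_tPerfect_induce hz h₂)
    refine convexHull_mono ?_ hmem
    rintro ⟨_, _⟩ ⟨⟨S, hS, rfl⟩, ⟨T, hT, rfl⟩⟩
    exact ⟨⟨(S, T), hS, hT⟩, rfl⟩
  obtain ⟨w, hw, hwz, hopt⟩ := exists_convex_combination_cost_minimal f
    (fun p => traceMismatch (⋃ i, X i) p.1.1 p.1.2) hz'
  have hz₁ : ∀ v ∈ V₁, ∑ p : ι, w p * charVec p.1.1 v = z v := by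
    intro v hv
    have := congrFun (congrArg Prod.fst hwz) v
    simpa [f, Prod.fst_sum, Finset.sum_apply, Set.indicator_of_mem hv] using this
  have hz₂ : ∀ v ∈ V₂, ∑ p : ι, w p * charVec p.1.2 v = z v := by
    intro v hv
    have := congrFun (congrArg Prod.snd hwz) v
    simpa [f, Prod.snd_sum, Finset.sum_apply, Set.indicator_of_mem hv] using this
  have hnot : ∀ x ∈ ⋃ i, X i, ∀ p q : ι, 0 < w p → 0 < w q → x ∈ p.1.1 → x ∉ p.1.2 →
      x ∉ q.1.1 → x ∈ q.1.2 → False := by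
    rintro x hx ⟨⟨S, T⟩, ⟨hS₁, hS⟩, ⟨hT₂, hT⟩⟩ ⟨⟨S', T'⟩, ⟨hS₁', hS'⟩, ⟨hT₂', hT'⟩⟩
      hp hq hxS hxT hxS' hxT'
    obtain ⟨i, hi⟩ := Set.mem_iUnion.1 hx
    obtain ⟨P, P', Q, Q', ⟨hP, hP', hQ, hQ'⟩, ⟨hPs, hPs', hQs, hQs'⟩, hPsum, hQsum, hlt⟩ :=
      h.exists_exchange hS hS' hT hT' hi hxS hxS' hxT hxT'
    refine absurd (hopt _ _
      ⟨(P, Q), ⟨hPs.trans (Set.union_subset hS₁ hS₁'), hP⟩,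
        hQs.trans (Set.union_subset hT₂' hT₂), hQ⟩
      ⟨(P', Q'), ⟨hPs'.trans (Set.union_subset hS₁ hS₁'), hP'⟩,
        hQs'.trans (Set.union_subset hT₂' hT₂), hQ'⟩ ?_ hp hq ?_) (not_le.2 hlt)
    · intro heq
      have : S = S' := congrArg (fun r : ι => r.1.1) heq
      exact hxS' (this ▸ hxS)
    · exact Prod.ext hPsum hQsum
  refine ⟨ι, inferInstance, w, hw, fun p => p.1.1, fun p => p.1.2, fun p => p.2.1,
    fun p => p.2.2, hz₁, hz₂, fun p hp x hx => ?_⟩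
  have hx' : x ∈ V₁ ∩ V₂ := hX hx
  have hbal : ∑ q : ι, w q * (charVec q.1.1 x - charVec q.1.2 x) = 0 := by
    simp only [mul_sub, Finset.sum_sub_distrib, hz₁ x hx'.1, hz₂ x hx'.2, sub_self]
  by_contra hne
  by_cases hxS : x ∈ p.1.1
  · have hxT : x ∉ p.1.2 := by tauto
    refine absurd hbal (ne_of_gt (Finset.sum_pos' (fun q _ => ?_) ⟨p, Finset.mem_univ p, ?_⟩))
    · rcases (hw.1 q).eq_or_lt with h0 | h0
      · simp [← h0]
      · refine mul_nonneg h0.le ?_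
        have := hnot x hx p q hp h0 hxS hxT
        by_cases h1 : x ∈ q.1.1 <;> by_cases h2 : x ∈ q.1.2 <;>
          simp_all [charVec, Set.indicator_apply]
    · simpa [charVec, hxS, hxT] using hp
  · have hxT : x ∈ p.1.2 := by tauto
    refine absurd hbal (ne_of_lt (Finset.sum_neg' (fun q _ => ?_) ⟨p, Finset.mem_univ p, ?_⟩))
    · rcases (hw.1 q).eq_or_lt with h0 | h0
      · simp [← h0]
      · refine mul_nonpos_of_nonneg_of_nonpos h0.le ?_
        have := hnot x hx q p h0 hp
        by_cases h1 : x ∈ q.1.1 <;> by_cases h2 : x ∈ q.1.2 <;>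
          simp_all [charVec, Set.indicator_apply]
    · simpa [charVec, hxS, hxT] using hp

/-- If both sides of a separation along a harmonious cutset are t-perfect, then so is the whole
graph. -/
theorem tPerfect_of_harmonious_separation [Fintype V] {V₁ V₂ : Set V} (hcov : V₁ ∪ V₂ = Set.univ)
    (hsep : ∀ u ∈ V₁ \ V₂, ∀ v ∈ V₂ \ V₁, ¬ G.Adj u v) {s : ℕ} {X : Fin s → Set V}
    (hX : ⋃ i, X i = V₁ ∩ V₂) (h : Harmonious G X)
    (h₁ : TPerfect (G.induce V₁)) (h₂ : TPerfect (G.induce V₂)) : TPerfect G := by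
  classical
  refine (SSP_subset_TSTAB G).antisymm fun z hz => ?_
  obtain ⟨ι, _, w, hw, S, T, hS, hT, hz₁, hz₂, hagree⟩ := h.exists_coupling hX.subset h₁ h₂ hz
  rw [hX] at hagree
  have hstable : ∀ p, 0 < w p → IsStable G (S p ∪ T p) := by
    intro p hp
    have hag := hagree p hp
    have hcross : ∀ u ∈ S p, ∀ v ∈ T p, ¬ G.Adj u v := by
      intro u hu v hv huv
      have hu₁ := (hS p).1 hu
      have hv₂ := (hT p).1 hv
      by_cases hu₂ : u ∈ V₂
      · exact (hT p).2 ((hag u ⟨hu₁, hu₂⟩).1 hu) hv huv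
      by_cases hv₁ : v ∈ V₁
      · exact (hS p).2 hu ((hag v ⟨hv₁, hv₂⟩).2 hv) huv
      exact hsep u ⟨hu₁, hu₂⟩ v ⟨hv₂, hv₁⟩ huv
    rintro u (hu | hu) v (hv | hv) huv
    · exact (hS p).2 hu hv huv
    · exact hcross u hu v hv huv
    · exact hcross v hv u hu huv.symm
    · exact (hT p).2 hu hv huv
  have hunion : ∀ p, 0 < w p → ∀ v, (v ∈ V₁ → (v ∈ S p ∪ T p ↔ v ∈ S p)) ∧
      (v ∈ V₂ → (v ∈ S p ∪ T p ↔ v ∈ T p)) := by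
    refine fun p hp v => ⟨fun hv => ⟨?_, Or.inl⟩, fun hv => ⟨?_, Or.inr⟩⟩
    · exact fun h => h.elim id fun h' => (hagree p hp v ⟨hv, (hT p).1 h'⟩).2 h'
    · exact fun h => h.elim (fun h' => (hagree p hp v ⟨(hS p).1 h', hv⟩).1 h') id
  have hzsum : z = ∑ p, w p • charVec (S p ∪ T p) := by
    ext v
    rw [Finset.sum_apply]
    have hv : v ∈ V₁ ∪ V₂ := hcov ▸ Set.mem_univ v
    rcases hv with hv | hv
    · rw [← hz₁ v hv]
      refine Finset.sum_congr rfl fun p _ => ?_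
      rcases (hw.1 p).eq_or_lt with h0 | h0
      · simp [← h0]
      · simp only [Pi.smul_apply, smul_eq_mul, charVec, Set.indicator_apply,
          (hunion p h0 v).1 hv]
    · rw [← hz₂ v hv]
      refine Finset.sum_congr rfl fun p _ => ?_
      rcases (hw.1 p).eq_or_lt with h0 | h0
      · simp [← h0]
      · simp only [Pi.smul_apply, smul_eq_mul, charVec, Set.indicator_apply,
          (hunion p h0 v).2 hv]
  have hres : ∑ p ∈ univ.filter (fun p => 0 < w p), w p • charVec (S p ∪ T p) = z := by
    rw [hzsum]
    refine Finset.sum_filter_of_ne fun p _ hne => (hw.1 p).lt_of_ne' ?_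
    rintro h0
    exact hne (by rw [h0, zero_smul])
  rw [← hres]
  refine (convex_convexHull ℝ _).sum_mem (fun p _ => hw.1 p) ?_ fun p hp => ?_
  · rw [← hw.2]
    exact Finset.sum_filter_of_ne fun p _ hne => (hw.1 p).lt_of_ne' hne
  · exact subset_convexHull ℝ _ ⟨_, hstable p (Finset.mem_filter.1 hp).2, rfl⟩

end Gluing

/-- Induced subgraphs of finite graphs are t-minors. -/
theorem isTMinor_of_embedding {V W : Type} [Finite V] {G : SimpleGraph V} {H : SimpleGraph W}
    (e : H ↪g G) : IsTMinor H G := by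
  induction hn : Nat.card V generalizing V with
  | zero =>
    have : IsEmpty V := (Nat.card_eq_zero.1 hn).resolve_right (not_infinite_iff_finite.2 ‹_›)
    exact .of_iso (RelIso.ofSurjective e isEmptyElim)
  | succ n ih =>
    by_cases hs : Function.Surjective e
    · exact .of_iso (RelIso.ofSurjective e hs)
    · obtain ⟨v, hv⟩ := not_forall.1 hs
      refine .delete v (ih ⟨⟨fun a => ⟨e a, fun h => hv ⟨a, h⟩⟩, fun a b hab => ?_⟩, ?_⟩ ?_)
      · exact e.injective (congrArg Subtype.val hab)
      · exact e.map_rel_iff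
      · have h1 := Set.ncard_add_ncard_compl ({v} : Set V)
        have h2 : ({u | u ≠ v} : Set V) = {v}ᶜ := rfl
        rw [Nat.card_coe_set_eq, h2]
        rw [Set.ncard_singleton] at h1
        omega

/-- A harmonious cutset of a t-imperfect graph yields a proper t-imperfect induced subgraph. -/
theorem IsHarmoniousCutset.exists_not_tPerfect_induce {V : Type} [Fintype V]
    {G : SimpleGraph V} (himp : ¬ TPerfect G) {X : Set V} (hX : IsHarmoniousCutset G X) :
    ∃ S : Set V, S ≠ Set.univ ∧ ¬ TPerfect (G.induce S) := by
  obtain ⟨⟨V₁, V₂, hcov, ⟨a, -, ha⟩, ⟨b, -, hb⟩, hsep, rfl⟩, s, Y, hY, hharm⟩ := hX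
  by_contra! hall
  exact himp (tPerfect_of_harmonious_separation hcov hsep hY hharm
    (hall V₁ fun h => hb (h ▸ Set.mem_univ b)) (hall V₂ fun h => ha (h ▸ Set.mem_univ a)))

/-- **Lemma 5.** If a finite simple t-imperfect graph contains a harmonious cutset,
then it has a proper induced subgraph that is t-imperfect. In particular, no
minimally t-imperfect graph admits a harmonious cutset. -/
theorem timperfect_of_harmonious_cutset {V : Type} [Fintype V] (G : SimpleGraph V)
    (himp : ¬ TPerfect G) :
    ((∃ X : Set V, IsHarmoniousCutset G X) →
      ∃ S : Set V, S ≠ Set.univ ∧ ¬ TPerfect (G.induce S)) ∧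
    ((∀ {W : Type} [Fintype W] (H : SimpleGraph W),
        IsTMinor H G → IsEmpty (H ≃g G) → TPerfect H) →
      ∀ X : Set V, ¬ IsHarmoniousCutset G X) := by

  have key {X : Set V} (hX : IsHarmoniousCutset G X) := hX.exists_not_tPerfect_induce himp
  refine ⟨fun ⟨X, hX⟩ => key hX, fun hmin X hX => ?_⟩
  obtain ⟨S, hS, hSimp⟩ := key hX
  have : Fintype S := Fintype.ofFinite S
  refine hSimp (hmin (G.induce S) (isTMinor_of_embedding (Embedding.induce S)) ⟨fun e => ?_⟩)
  have hcard := Nat.card_congr e.toEquiv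
  rw [Nat.card_coe_set_eq] at hcard
  exact hS ((Set.eq_univ_iff_ncard S).2 hcard)
end

section
/- Let G be a finite simple graph and let (X,Y) be a G-harmonious tuple (where X or Y may be empty). If S1,…,Sk are stable sets of G, then there exist stable sets S'1,…,S'k of G such that S'1 ∩ X ⊆ S'2 ∩ X ⊆ … ⊆ S'k ∩ X, S'1 ∩ Y ⊇ S'2 ∩ Y ⊇ … ⊇ S'k ∩ Y, and Σ_{i=1}^k χ_{S'_i} = Σ_{i=1}^k χ_{S_i}. -/
open Finset SimpleGraph

/-- A walk of minimal length in a spanning subgraph `H ≤ G` is an induced path of `G`, provided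
`H` and `G` agree on the vertices of the walk. -/
theorem isInducedPath_mapLe_of_length_eq_dist {V : Type} {G H : SimpleGraph V} (hle : H ≤ G)
    {u v : V} (p : H.Walk u v) (hp : p.length = H.dist u v)
    (hind : ∀ a ∈ p.support, ∀ b ∈ p.support, G.Adj a b → H.Adj a b) :
    IsInducedPath G (p.mapLe hle) := by
  have key : ∀ i j, i < j → j ≤ p.length → H.Adj (p.getVert i) (p.getVert j) → j = i + 1 := by
    intro i j hij hj hadj
    have h := dist_le ((p.take i).append (Walk.cons hadj (p.drop j)))
    simp only [Walk.length_append, Walk.length_cons, Walk.take_length, Walk.drop_length] at h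
    omega
  refine ⟨(Walk.isPath_mapLe hle).2 (p.isPath_of_length_eq_dist hp), ?_⟩
  intro a ha b hb hadj
  simp only [Walk.mem_verts_toSubgraph, Walk.support_mapLe_eq_support] at ha hb
  have hH := hind a ha b hb hadj
  obtain ⟨i, rfl, hi⟩ := Walk.mem_support_iff_exists_getVert.1 ha
  obtain ⟨j, rfl, hj⟩ := Walk.mem_support_iff_exists_getVert.1 hb
  have step : ∀ l < p.length,
      (p.mapLe hle).toSubgraph.Adj (p.getVert l) (p.getVert (l + 1)) := by
    intro l hl
    have h := (p.mapLe hle).toSubgraph_adj_getVert (i := l) (by simpa using hl)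
    simpa [Walk.mapLe, Walk.getVert_map] using h
  rcases lt_trichotomy i j with h | h | h
  · obtain rfl := key i j h hj hH
    exact step i (by omega)
  · subst h
    exact absurd hH (H.loopless.irrefl _)
  · obtain rfl := key j i h hi hH.symm
    exact (step j (by omega)).symm

/-- Along a walk whose edges all leave or enter `S`, the parity of the length tells whether the
endpoints lie on the same side of `S`. -/
theorem even_length_iff_mem_iff_mem {V : Type} {H : SimpleGraph V} {S : Set V}
    (hS : ∀ a b, H.Adj a b → (a ∈ S ↔ b ∉ S)) {u v : V} (p : H.Walk u v) :
    Even p.length ↔ (u ∈ S ↔ v ∈ S) := by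
  induction p with
  | nil => simp
  | cons h p ih =>
    have := hS _ _ h
    rw [Walk.length_cons, Nat.even_add_one, ih]
    tauto

/-- The graph keeping the edges of `G` with both ends in exactly one of `S` and `T`. -/
def symmDiffGraph {V : Type} (G : SimpleGraph V) (S T : Set V) : SimpleGraph V where
  Adj a b := G.Adj a b ∧ (a ∈ S ↔ a ∉ T) ∧ (b ∈ S ↔ b ∉ T)
  symm := ⟨fun _ _ h => ⟨h.1.symm, h.2.2, h.2.1⟩⟩
  loopless := ⟨fun _ h => G.loopless.irrefl _ h.1⟩

/-- In a component of the graph on the symmetric difference of two stable sets, two vertices are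
joined by an induced path of `G` whose parity is determined by the sides they lie on. -/
theorem exists_isInducedPath_of_reachable {V : Type} {G : SimpleGraph V} {S T : Set V}
    (hS : IsStable G S) (hT : IsStable G T) {u v : V} (hu : u ∈ S ↔ u ∉ T)
    (h : (symmDiffGraph G S T).Reachable u v) :
    ∃ p : G.Walk u v, IsInducedPath G p ∧ (Even p.length ↔ (u ∈ S ↔ v ∈ S)) := by
  have hmem : ∀ a b, (symmDiffGraph G S T).Walk a b → (a ∈ S ↔ a ∉ T) → (b ∈ S ↔ b ∉ T) := by
    intro a b p
    induction p with
    | nil => exact id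
    | cons h _ ih => exact fun _ => ih h.2.2
  have hle : symmDiffGraph G S T ≤ G := fun _ _ h => h.1
  obtain ⟨p, hp⟩ := h.exists_walk_length_eq_dist
  have hsupp : ∀ a ∈ p.support, (a ∈ S ↔ a ∉ T) := by
    classical
    exact fun a ha => hmem _ _ (p.takeUntil a ha) hu
  refine ⟨p.mapLe hle, isInducedPath_mapLe_of_length_eq_dist hle p hp
    fun a ha b hb hab => ⟨hab, hsupp a ha, hsupp b hb⟩, ?_⟩
  rw [Walk.mapLe, Walk.length_map]
  refine even_length_iff_mem_iff_mem (fun a b hab => ?_) p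
  obtain ⟨hG, ha, hb⟩ := hab
  have h₁ : a ∈ S → b ∉ S := fun x y => hS x y hG
  have h₂ : a ∈ T → b ∉ T := fun x y => hT x y hG
  tauto

/-- Two stable sets can be exchanged along components of their symmetric difference so that
they become nested on both parts of a harmonious pair. -/
theorem Harmonious.exists_exchange_s8 {V : Type} {G : SimpleGraph V} {X Y : Set V}
    (hXY : Harmonious G ![X, Y]) {S T : Set V} (hS : IsStable G S) (hT : IsStable G T) :
    ∃ S' T' : Set V, IsStable G S' ∧ IsStable G T' ∧
      charVec S' + charVec T' = charVec S + charVec T ∧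
      (∀ v ∈ X, (v ∈ S' ↔ v ∈ S ∧ v ∈ T) ∧ (v ∈ T' ↔ v ∈ S ∨ v ∈ T)) ∧
      (∀ v ∈ Y, (v ∈ S' ↔ v ∈ S ∨ v ∈ T) ∧ (v ∈ T' ↔ v ∈ S ∧ v ∈ T)) := by
  classical
  obtain ⟨-, hpar, -⟩ := hXY
  have hXX : ∀ a ∈ X, ∀ b ∈ X, (a ∈ S ↔ a ∉ T) → (symmDiffGraph G S T).Reachable a b →
      (a ∈ S ↔ b ∈ S) := fun a ha b hb hab hr => by
    obtain ⟨p, hp, he⟩ := exists_isInducedPath_of_reachable hS hT hab hr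
    exact he.1 ((hpar 0 0 a b p ha hb hp).2 rfl)
  have hYY : ∀ a ∈ Y, ∀ b ∈ Y, (a ∈ S ↔ a ∉ T) → (symmDiffGraph G S T).Reachable a b →
      (a ∈ S ↔ b ∈ S) := fun a ha b hb hab hr => by
    obtain ⟨p, hp, he⟩ := exists_isInducedPath_of_reachable hS hT hab hr
    exact he.1 ((hpar 1 1 a b p ha hb hp).2 rfl)
  have hX_Y : ∀ a ∈ X, ∀ b ∈ Y, (a ∈ S ↔ a ∉ T) → (symmDiffGraph G S T).Reachable a b →
      ¬ (a ∈ S ↔ b ∈ S) := fun a ha b hb hab hr h => by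
    obtain ⟨p, hp, he⟩ := exists_isInducedPath_of_reachable hS hT hab hr
    exact absurd ((hpar 0 1 a b p ha hb hp).1 (he.2 h)) (by decide)
  have hY_X : ∀ a ∈ Y, ∀ b ∈ X, (a ∈ S ↔ a ∉ T) → (symmDiffGraph G S T).Reachable a b →
      ¬ (a ∈ S ↔ b ∈ S) := fun a ha b hb hab hr h => by
    obtain ⟨p, hp, he⟩ := exists_isInducedPath_of_reachable hS hT hab hr
    exact absurd ((hpar 1 0 a b p ha hb hp).1 (he.2 h)) (by decide)
  set D : Set V := {v | ∃ a, (symmDiffGraph G S T).Reachable a v ∧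
    (a ∈ X ∧ a ∈ S ∧ a ∉ T ∨ a ∈ Y ∧ a ∈ T ∧ a ∉ S)} with hD
  have hDadj : ∀ u v, u ∈ D → G.Adj u v → (u ∈ S ↔ u ∉ T) → (v ∈ S ↔ v ∉ T) → v ∈ D := by
    rintro u v ⟨a, hr, ha⟩ hadj hu hv
    have huv : (symmDiffGraph G S T).Adj u v := ⟨hadj, hu, hv⟩
    exact ⟨a, hr.trans huv.reachable, ha⟩
  have hDX : ∀ v ∈ X, (v ∈ S ↔ v ∉ T) → (v ∈ D ↔ v ∈ S) := by
    refine fun v hv hST => ⟨?_, fun h => ⟨v, Reachable.refl v, .inl ⟨hv, h, hST.1 h⟩⟩⟩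
    rintro ⟨a, hr, ⟨haX, haS, haT⟩ | ⟨haY, haT, haS⟩⟩
    · have := hXX a haX v hv (by tauto) hr
      tauto
    · have := hY_X a haY v hv (by tauto) hr
      tauto
  have hDY : ∀ v ∈ Y, (v ∈ S ↔ v ∉ T) → (v ∈ D ↔ v ∈ T) := by
    refine fun v hv hST => ⟨?_, fun h => ⟨v, Reachable.refl v, .inr ⟨hv, h, by tauto⟩⟩⟩
    rintro ⟨a, hr, ⟨haX, haS, haT⟩ | ⟨haY, haT, haS⟩⟩
    · have := hX_Y a haX v hv (by tauto) hr
      tauto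
    · have := hYY a haY v hv (by tauto) hr
      tauto
  clear_value D
  have hstable : ∀ A B : Set V, IsStable G A → IsStable G B →
      (∀ u v, u ∈ D → G.Adj u v → (u ∈ A ↔ u ∉ B) → (v ∈ A ↔ v ∉ B) → v ∈ D) →
      IsStable G {v | if v ∈ D then v ∈ B else v ∈ A} := by
    intro A B hA hB hAB
    have hcross : ∀ u v, G.Adj u v → u ∈ D → u ∈ B → v ∉ D → v ∈ A → False := by
      intro u v hadj hu huB hv hvA
      have h₁ : u ∉ A := fun h => hA h hvA hadj
      have h₂ : v ∉ B := fun h => hB huB h hadj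
      exact hv (hAB u v hu hadj (by tauto) (by tauto))
    intro u hu v hv hadj
    simp only [Set.mem_ofPred_eq] at hu hv
    split_ifs at hu hv with h₁ h₂ h₂
    · exact hB hu hv hadj
    · exact hcross u v hadj h₁ hu h₂ hv
    · exact hcross v u hadj.symm h₂ hv h₁ hu
    · exact hA hu hv hadj
  refine ⟨{v | if v ∈ D then v ∈ T else v ∈ S}, {v | if v ∈ D then v ∈ S else v ∈ T},
    hstable S T hS hT hDadj, hstable T S hT hS fun u v h₁ h₂ h₃ h₄ =>
      hDadj u v h₁ h₂ (by tauto) (by tauto), ?_, fun v hv => ?_, fun v hv => ?_⟩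
  · ext v
    by_cases h : v ∈ D <;> simp [charVec, Set.indicator_apply, h, add_comm]
  · have := hDX v hv
    by_cases h : v ∈ D <;> simp only [Set.mem_ofPred_eq, h, if_true, if_false] <;> tauto
  · have := hDY v hv
    by_cases h : v ∈ D <;> simp only [Set.mem_ofPred_eq, h, if_true, if_false] <;> tauto

/-- Replacing the entries of a tuple at two distinct places changes a sum over the tuple by the
changes at these places. -/
theorem sum_update_update_sub {ι α M : Type*} [Fintype ι] [DecidableEq ι] [AddCommGroup M]
    (g : ι → α → M) (f : ι → α) {i j : ι} (hij : i ≠ j) (a b : α) :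
    ∑ l, g l (Function.update (Function.update f i a) j b l) - ∑ l, g l (f l) =
      (g i a - g i (f i)) + (g j b - g j (f j)) := by
  rw [← Finset.sum_sub_distrib, Fintype.sum_eq_add i j hij]
  · simp [hij]
  · rintro l ⟨hi, hj⟩
    simp [hi, hj]

/-- **Lemma 7.** Given a `G`-harmonious tuple `(X, Y)` and stable sets `S 1, …, S k`,
there are stable sets `S' 1, …, S' k`, increasingly nested on `X` and decreasingly
nested on `Y`, whose characteristic vectors have the same sum. -/
theorem force_nested {V : Type} [Fintype V] (G : SimpleGraph V) (X Y : Set V)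
    (hXY : Harmonious G ![X, Y]) {k : ℕ} (S : Fin k → Set V)
    (hS : ∀ i, IsStable G (S i)) :
    ∃ S' : Fin k → Set V, (∀ i, IsStable G (S' i)) ∧
      (∀ i j : Fin k, i ≤ j → S' i ∩ X ⊆ S' j ∩ X) ∧
      (∀ i j : Fin k, i ≤ j → S' j ∩ Y ⊆ S' i ∩ Y) ∧
      ∑ i, charVec (S' i) = ∑ i, charVec (S i) := by
  classical
  have hdisj : ∀ v ∈ X, v ∉ Y := fun v hX hY =>
    Set.disjoint_left.1 (hXY.1 0 1 (by decide)) hX hY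
  let weight : Set V → ℝ := fun A => ∑ v, (charVec X v - charVec Y v) * charVec A v
  let potential : (Fin k → Set V) → ℝ := fun F => ∑ i : Fin k, (i : ℝ) * weight (F i)
  obtain ⟨F, ⟨hF, hsum⟩, hmax⟩ := Set.exists_max_image
    {F : Fin k → Set V | (∀ i, IsStable G (F i)) ∧ ∑ i, charVec (F i) = ∑ i, charVec (S i)}
    potential (Set.toFinite _) ⟨S, hS, rfl⟩
  have hnested : ∀ i j : Fin k, i < j →
      (∀ v ∈ X, v ∈ F i → v ∈ F j) ∧ (∀ v ∈ Y, v ∈ F j → v ∈ F i) := by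
    intro i j hij
    obtain ⟨A, B, hA, hB, hAB, hX, hY⟩ := hXY.exists_exchange_s8 (hF i) (hF j)
    have hpot := hmax (Function.update (Function.update F i A) j B) ⟨fun l => ?_, ?_⟩
    · have hdiff := sum_update_update_sub (fun (l : Fin k) C => (l : ℝ) * weight C) F hij.ne A B
      have hweight : weight A + weight B = weight (F i) + weight (F j) := by
        simp only [weight, ← Finset.sum_add_distrib, ← mul_add]
        exact Finset.sum_congr rfl fun v _ => congrArg _ (congrFun hAB v)
      have hlt : (i : ℝ) < j := by exact_mod_cast hij
      have hle : weight B - weight (F j) ≤ 0 := by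
        simp only [potential] at hpot
        nlinarith
      have hterm : ∀ v, 0 ≤ (charVec X v - charVec Y v) * charVec B v -
          (charVec X v - charVec Y v) * charVec (F j) v := by
        intro v
        have hd := hdisj v
        have hx := hX v
        have hy := hY v
        simp only [charVec, Set.indicator_apply, Pi.one_apply]
        by_cases h₁ : v ∈ X
        · by_cases h₂ : v ∈ F i <;> by_cases h₃ : v ∈ F j <;> simp_all
        · by_cases h₄ : v ∈ Y
          · by_cases h₂ : v ∈ F i <;> by_cases h₃ : v ∈ F j <;> simp_all
          · simp [h₁, h₄]
      have hzero : ∀ v, (charVec X v - charVec Y v) * charVec B v -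
          (charVec X v - charVec Y v) * charVec (F j) v = 0 := by
        have h₀ : ∑ v, ((charVec X v - charVec Y v) * charVec B v -
            (charVec X v - charVec Y v) * charVec (F j) v) = 0 := by
          refine le_antisymm ?_ (Finset.sum_nonneg fun v _ => hterm v)
          rw [Finset.sum_sub_distrib]
          exact hle
        exact fun v => (Finset.sum_eq_zero_iff_of_nonneg fun v _ => hterm v).1 h₀ v (mem_univ v)
      refine ⟨fun v hv hi => ?_, fun v hv hj => ?_⟩ <;>
      · have hz := hzero v
        have hd : v ∈ Y → v ∉ X := fun hvY hvX => hdisj v hvX hvY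
        have hx := hX v
        have hy := hY v
        simp only [charVec, Set.indicator_apply, Pi.one_apply] at hz
        by_contra hcon
        simp_all
    · rcases eq_or_ne l j with rfl | hl
      · simpa using hB
      · rcases eq_or_ne l i with rfl | hl'
        · simpa [hl] using hA
        · simpa [hl, hl'] using hF l
    · have h := sum_update_update_sub (fun _ C => charVec C) F hij.ne A B
      rw [← hsum, ← sub_eq_zero, h, sub_add_sub_comm, hAB, sub_self]
  refine ⟨F, hF, fun i j hij => ?_, fun i j hij => ?_, hsum⟩ <;>
    rcases hij.eq_or_lt with rfl | hlt
  · exact subset_rfl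
  · exact fun v hv => ⟨(hnested i j hlt).1 v hv.2 hv.1, hv.2⟩
  · exact subset_rfl
  · exact fun v hv => ⟨(hnested i j hlt).2 v hv.2 hv.1, hv.2⟩
end

section
/- Let G be a finite simple graph and let (X,Y) be a G-harmonious tuple. Then for any two stable sets S and T of G there exist stable sets S' and T' of G such that χ_S + χ_T = χ_{S'} + χ_{T'} and S' ∩ X ⊆ T' ∩ X. -/
open Finset SimpleGraph

/-- A shortest walk has no chords. -/
theorem isChordless_of_length_eq_dist {V : Type} {G : SimpleGraph V} {u v : V} (p : G.Walk u v)
    (hp : p.length = G.dist u v) : p.IsChordless := by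
  rw [← Walk.isInduced_toSubgraph]
  have key : ∀ i j, i ≤ j → j ≤ p.length → G.Adj (p.getVert i) (p.getVert j) →
      p.toSubgraph.Adj (p.getVert i) (p.getVert j) := by
    intro i j hij hj hadj
    have hne : i ≠ j := by
      rintro rfl
      exact G.irrefl hadj
    have hle := dist_le ((p.take i).append (Walk.cons hadj (p.drop j)))
    rw [← hp, Walk.length_append, Walk.length_cons, Walk.take_length, Walk.drop_length] at hle
    obtain rfl : j = i + 1 := by omega
    exact p.toSubgraph_adj_getVert (by omega)
  intro a ha b hb hab
  rw [Walk.mem_verts_toSubgraph, Walk.mem_support_iff_exists_getVert] at ha hb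
  obtain ⟨i, rfl, hi⟩ := ha
  obtain ⟨j, rfl, hj⟩ := hb
  rcases le_total i j with h | h
  · exact key i j h hj hab
  · exact (key j i h hi hab.symm).symm

/-- The bipartite graph formed by the edges of `G` between `S \ T` and `T \ S`. -/
def exchangeGraph {V : Type} (G : SimpleGraph V) (S T : Set V) : SimpleGraph V where
  Adj u v := G.Adj u v ∧ (u ∈ S \ T ∧ v ∈ T \ S ∨ u ∈ T \ S ∧ v ∈ S \ T)
  symm := ⟨fun _ _ h => ⟨h.1.symm, h.2.symm.imp And.symm And.symm⟩⟩
  loopless := ⟨fun _ h => G.irrefl h.1⟩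

section exchangeGraph

variable {V : Type} {G : SimpleGraph V} {S T : Set V}

theorem exchangeGraph_le : exchangeGraph G S T ≤ G := fun _ _ h => h.1

/-- For stable `S` and `T`, the exchange graph contains all edges of `G` on `S ∆ T`. -/
theorem exchangeGraph_adj (hS : IsStable G S) (hT : IsStable G T) {u v : V}
    (hu : u ∈ symmDiff S T) (hv : v ∈ symmDiff S T) (h : G.Adj u v) :
    (exchangeGraph G S T).Adj u v := by
  refine ⟨h, ?_⟩
  rcases hu with hu | hu <;> rcases hv with hv | hv
  · exact (hS hu.1 hv.1 h).elim
  · exact Or.inl ⟨hu, hv⟩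
  · exact Or.inr ⟨hu, hv⟩
  · exact (hT hu.1 hv.1 h).elim

theorem mem_symmDiff_of_mem_support {u v : V} (p : (exchangeGraph G S T).Walk u v)
    (hu : u ∈ symmDiff S T) {w : V} (hw : w ∈ p.support) : w ∈ symmDiff S T := by
  induction p with
  | nil => simp_all
  | cons h p ih =>
    rw [Walk.support_cons, List.mem_cons] at hw
    rcases hw with rfl | hw
    · exact hu
    · exact ih (h.2.elim (fun h => Or.inr h.2) fun h => Or.inl h.2) hw

theorem even_length_iff_of_exchangeGraph_walk {u v : V} (p : (exchangeGraph G S T).Walk u v) :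
    Even p.length ↔ (u ∈ S ↔ v ∈ S) := by
  induction p with
  | nil => simp
  | cons h p ih =>
    rw [Walk.length_cons, Nat.even_add_one, ih]
    rcases h.2 with ⟨h₁, h₂⟩ | ⟨h₁, h₂⟩
    · have := h₁.1
      have := h₂.2
      tauto
    · have := h₁.2
      have := h₂.1
      tauto

/-- Vertices of `S ∆ T` connected in the exchange graph are joined by an induced path of `G`
whose parity records whether they lie on the same side. -/
theorem exists_isInducedPath_of_exchangeGraph_reachable (hS : IsStable G S) (hT : IsStable G T)
    {u v : V} (hu : u ∈ symmDiff S T) (h : (exchangeGraph G S T).Reachable u v) :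
    ∃ p : G.Walk u v, IsInducedPath G p ∧ (Even p.length ↔ (u ∈ S ↔ v ∈ S)) := by
  obtain ⟨p, hpath, hp⟩ := h.exists_path_of_dist
  refine ⟨p.mapLe exchangeGraph_le, ⟨hpath.mapLe _, ?_⟩, ?_⟩
  · have hind := Walk.isInduced_toSubgraph.mpr (isChordless_of_length_eq_dist p hp)
    intro a ha b hb hab
    rw [Walk.mem_verts_toSubgraph, Walk.support_mapLe_eq_support] at ha hb
    rw [Walk.adj_toSubgraph_mapLe]
    exact hind (p.mem_verts_toSubgraph.mpr ha) (p.mem_verts_toSubgraph.mpr hb)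
      (exchangeGraph_adj hS hT (mem_symmDiff_of_mem_support p hu ha)
        (mem_symmDiff_of_mem_support p hu hb) hab)
  · rw [Walk.length_mapLe, even_length_iff_of_exchangeGraph_walk p]

/-- Swapping `S` and `T` on a union of components of the exchange graph preserves stability. -/
theorem IsStable.exchange (hS : IsStable G S) (hT : IsStable G T) {A : Set V}
    (hA : ∀ ⦃u v⦄, (exchangeGraph G S T).Adj u v → (u ∈ A ↔ v ∈ A)) :
    IsStable G (S \ A ∪ T ∩ A) := by
  have key : ∀ ⦃u⦄, u ∈ S \ A → ∀ ⦃v⦄, v ∈ T ∩ A → ¬ G.Adj u v := by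
    intro u hu v hv huv
    have huT : u ∉ T := fun h => hT h hv.1 huv
    have hvS : v ∉ S := fun h => hS hu.1 h huv
    exact hu.2 ((hA ⟨huv, Or.inl ⟨⟨hu.1, huT⟩, hv.1, hvS⟩⟩).mpr hv.2)
  rintro u (hu | hu) v (hv | hv) huv
  · exact hS hu.1 hv.1 huv
  · exact key hu hv huv
  · exact key hv hu huv.symm
  · exact hT hu.1 hv.1 huv

end exchangeGraph

theorem charVec_add_exchange {V : Type} (S T A : Set V) :
    charVec S + charVec T = charVec (S \ A ∪ T ∩ A) + charVec (T \ A ∪ S ∩ A) := by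
  classical
  ext v
  by_cases hS : v ∈ S <;> by_cases hT : v ∈ T <;> by_cases hA : v ∈ A <;>
    simp [charVec, hS, hT, hA]

/-- Claim (1) in the proof of Lemma 7: for any two stable sets `S`, `T` there are
stable sets `S'`, `T'` with `χ_S + χ_T = χ_{S'} + χ_{T'}` and `S' ∩ X ⊆ T' ∩ X`. -/
theorem exchange_on_X {V : Type} [Fintype V] (G : SimpleGraph V) (X Y : Set V)
    (hXY : Harmonious G ![X, Y]) (S T : Set V)
    (hS : IsStable G S) (hT : IsStable G T) :
    ∃ S' T' : Set V, IsStable G S' ∧ IsStable G T' ∧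
      charVec S + charVec T = charVec S' + charVec T' ∧ S' ∩ X ⊆ T' ∩ X := by
  set A : Set V := {v | ∃ u ∈ (S \ T) ∩ X, (exchangeGraph G S T).Reachable u v}
  have hA : ∀ ⦃u v⦄, (exchangeGraph G S T).Adj u v → (u ∈ A ↔ v ∈ A) := fun u v h =>
    ⟨fun ⟨w, hw, hr⟩ => ⟨w, hw, hr.trans h.reachable⟩,
      fun ⟨w, hw, hr⟩ => ⟨w, hw, hr.trans h.symm.reachable⟩⟩
  have hA' : ∀ ⦃u v⦄, (exchangeGraph G T S).Adj u v → (u ∈ A ↔ v ∈ A) :=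
    fun u v h => hA ⟨h.1, h.2.symm⟩
  refine ⟨S \ A ∪ T ∩ A, T \ A ∪ S ∩ A, hS.exchange hT hA, hT.exchange hS hA',
    charVec_add_exchange S T A, ?_⟩
  rintro v ⟨⟨hvS, hvA⟩ | ⟨hvT, hvA⟩, hvX⟩
  · refine ⟨Or.inl ⟨?_, hvA⟩, hvX⟩
    by_contra hvT
    exact hvA ⟨v, ⟨⟨hvS, hvT⟩, hvX⟩, Reachable.refl v⟩
  · refine ⟨Or.inr ⟨?_, hvA⟩, hvX⟩
    obtain ⟨u, ⟨huST, huX⟩, hr⟩ := hvA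
    obtain ⟨p, hp, hpar⟩ :=
      exists_isInducedPath_of_exchangeGraph_reachable hS hT (Or.inl huST) hr
    exact (hpar.mp ((hXY.2.1 0 0 u v p huX hvX hp).mpr rfl)).mp huST.1
end

section
/- Let G be a finite simple graph, let V1, V2 be vertex sets with V1 ∪ V2 = V(G), V1∖V2 ≠ ∅ ≠ V2∖V1 and no edge of G between V1∖V2 and V2∖V1, and suppose X = V1 ∩ V2 is a harmonious cutset of G (witnessed by this separation). Let G1 = G[V1] and G2 = G[V2] be the induced subgraphs. If z ∈ ℚ^{V(G)} is a vector whose restriction to V1 lies in SSP(G1) and whose restriction to V2 lies in SSP(G2), then z ∈ SSP(G). -/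
open Finset SimpleGraph

/-- A shortest walk is an induced path. -/
lemma SimpleGraph.Walk.isInducedPath_of_length_eq_dist {V : Type} {G : SimpleGraph V} {u v : V}
    (p : G.Walk u v) (hp : p.length = G.dist u v) : IsInducedPath G p := by
  refine ⟨p.isPath_of_length_eq_dist hp, ?_⟩
  have hdist (i : ℕ) (hi : i ≤ p.length) : G.dist u (p.getVert i) = i := by
    rw [← length_eq_dist_of_subwalk hp (p.isSubwalk_take i), Walk.take_length, min_eq_left hi]
  intro a ha b hb hab
  rw [Walk.mem_verts_toSubgraph, Walk.mem_support_iff_exists_getVert] at ha hb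
  obtain ⟨i, rfl, hi⟩ := ha
  obtain ⟨j, rfl, hj⟩ := hb
  have hne : i ≠ j := by rintro rfl; exact hab.ne rfl
  have h1 := hab.diff_dist_adj (u := u)
  rw [hdist i hi, hdist j hj] at h1
  obtain rfl | rfl : j = i + 1 ∨ i = j + 1 := by lia
  · exact p.toSubgraph_adj_getVert (by lia)
  · exact (p.toSubgraph_adj_getVert (by lia)).symm

/-- Induced paths of an induced subgraph are induced paths of the ambient graph. -/
lemma IsInducedPath.map_induce {V : Type} {G : SimpleGraph V} {D : Set V} {u v : D}
    {p : (G.induce D).Walk u v} (hp : IsInducedPath (G.induce D) p) :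
    IsInducedPath G (p.map (Embedding.induce D).toHom) := by
  refine ⟨hp.1.map Subtype.val_injective, ?_⟩
  rw [Walk.toSubgraph_map]
  rintro _ ⟨a, ha, rfl⟩ _ ⟨b, hb, rfl⟩ hab
  exact ⟨a, b, hp.2 ha hb hab, rfl, rfl⟩

/-- Two vertices in the same component of the symmetric difference of two stable sets are joined
by an induced path, whose parity tells whether they lie in the same one of the two sets. -/
lemma IsStable.exists_isInducedPath {V : Type} {G : SimpleGraph V} {S R : Set V}
    (hS : IsStable G S) (hR : IsStable G R) {u w : ↥(symmDiff S R)}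
    (h : (G.induce (symmDiff S R)).Reachable u w) :
    ∃ p : G.Walk u w, IsInducedPath G p ∧ (Even p.length ↔ ((u : V) ∈ S ↔ (w : V) ∈ S)) := by
  classical
  obtain ⟨p, hp⟩ := h.exists_walk_length_eq_dist
  refine ⟨_, (p.isInducedPath_of_length_eq_dist hp).map_induce, ?_⟩
  let c : (G.induce (symmDiff S R)).Coloring Bool := Coloring.mk (fun x => decide ((x : V) ∈ S)) (by
    rintro ⟨a, ha⟩ ⟨b, hb⟩ hab
    have h1 := @hS a
    have h2 := @hR a
    have hab : G.Adj a b := hab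
    simp only [Set.mem_symmDiff] at ha hb
    have h3 : ¬ (a ∈ S ∧ b ∈ S) := fun h => hS h.1 h.2 hab
    have h4 : ¬ (a ∈ R ∧ b ∈ R) := fun h => hR h.1 h.2 hab
    simp only [ne_eq, decide_eq_decide]
    tauto)
  have hc : Even p.length ↔ ((u : V) ∈ S ↔ (w : V) ∈ S) := by
    rw [c.even_length_iff_congr p]
    exact iff_congr decide_eq_true_iff decide_eq_true_iff
  exact (iff_of_eq (congrArg Even (Walk.length_map _ p))).trans hc

/-- Exchanging components of the symmetric difference of two stable sets aligns their traces on
a harmonious set: the first set gets as much as possible of one part and the second set as much as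
possible of all other parts. -/
lemma Harmonious.exists_exchange_s10 {V : Type} {G : SimpleGraph V} {s : ℕ} {X : Fin s → Set V}
    (hX : Harmonious G X) {S R : Set V} (hS : IsStable G S) (hR : IsStable G R)
    {i : Fin s} {v : V} (hvi : v ∈ X i) (hvS : v ∈ S) :
    ∃ S' R' : Set V, IsStable G S' ∧ IsStable G R' ∧
      (∀ x, (x ∈ S' ∨ x ∈ R' ↔ x ∈ S ∨ x ∈ R) ∧ (x ∈ S' ∧ x ∈ R' ↔ x ∈ S ∧ x ∈ R)) ∧
      (∀ x ∈ X i, x ∈ R' → x ∈ S') ∧ (∀ j, j ≠ i → ∀ x ∈ X j, x ∈ S' → x ∈ R') := by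
  obtain ⟨hdisj, hpar, hcomp⟩ := hX
  set D := symmDiff S R
  -- `wrong y`: the membership of `y` in `S` is opposite to the desired one
  let wrong (y : V) : Prop := (y ∈ X i ∧ y ∉ S) ∨ (∃ j, j ≠ i ∧ y ∈ X j ∧ y ∈ S)
  let flip (x : V) : Prop := ∃ (hx : x ∈ D) (y : D), (G.induce D).Reachable ⟨x, hx⟩ y ∧ wrong y
  have hflip {a b : V} (ha : a ∈ D) (hb : b ∈ D) (hab : G.Adj a b) : flip a → flip b := by
    rintro ⟨_, y, hy, hw⟩
    refine ⟨hb, y, Reachable.trans (Adj.reachable ?_) hy, hw⟩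
    exact hab.symm
  have hself {a : V} (ha : a ∈ D) (hw : wrong a) : flip a := ⟨ha, ⟨a, ha⟩, Reachable.refl _, hw⟩
  have hmemD (x : V) : x ∈ D ↔ (x ∈ S ∧ x ∉ R ∨ x ∈ R ∧ x ∉ S) := Set.mem_symmDiff
  -- no component contains both right and wrong vertices
  have hkey {j k : Fin s} {a b : D} (haj : (a : V) ∈ X j) (hbk : (b : V) ∈ X k)
      (hr : (G.induce D).Reachable a b) :
      (j = i ↔ k = i) ↔ ((a : V) ∈ S ↔ (b : V) ∈ S) := by
    obtain ⟨p, hp, hpe⟩ := hS.exists_isInducedPath hR hr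
    rw [← hpe, hpar j k _ _ p haj hbk hp]
    constructor
    · intro h
      by_contra hjk
      have hji : j ≠ i := by rintro rfl; tauto
      have hki : k ≠ i := by rintro rfl; tauto
      have hs : 3 ≤ s := by
        have := Finset.card_le_univ ({i, j, k} : Finset (Fin s))
        rwa [Finset.card_eq_three.2 ⟨i, j, k, hji.symm, hki.symm, hjk, rfl⟩,
          Fintype.card_fin] at this
      have haS : (a : V) ∉ S := fun h => hS h hvS (hcomp hs j i hji _ haj _ hvi)
      have hbS : (b : V) ∉ S := fun h => hS h hvS (hcomp hs k i hki _ hbk _ hvi)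
      have haR : (a : V) ∈ R := by have := (hmemD a).1 a.2; tauto
      have hbR : (b : V) ∈ R := by have := (hmemD b).1 b.2; tauto
      exact hR haR hbR (hcomp hs j k hjk _ haj _ hbk)
    · rintro rfl
      rfl
  have hright {j : Fin s} {x : V} (hx : x ∈ D) (hxj : x ∈ X j) (hf : flip x) :
      ¬ (j = i ↔ x ∈ S) := by
    obtain ⟨_, y, hy, hw⟩ := hf
    obtain ⟨hyi, hyS⟩ | ⟨k, hki, hyk, hyS⟩ := hw
    · have := hkey (a := ⟨x, hx⟩) hxj hyi hy
      simp only at this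
      tauto
    · have := hkey (a := ⟨x, hx⟩) hxj hyk hy
      simp only at this
      tauto
  have hstable {A B : Set V} (hA : IsStable G A) (hB : IsStable G B)
      (hAB : ∀ x, x ∈ D ↔ (x ∈ A ∧ x ∉ B ∨ x ∈ B ∧ x ∉ A)) :
      IsStable G {x | (x ∈ A ∧ ¬ flip x) ∨ (x ∈ B ∧ flip x)} := by
    intro a ha b hb hab
    have h1 : ¬ (a ∈ A ∧ b ∈ A) := fun h => hA h.1 h.2 hab
    have h2 : ¬ (a ∈ B ∧ b ∈ B) := fun h => hB h.1 h.2 hab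
    have h3 := hAB a
    have h4 := hAB b
    have h5 : a ∈ D → b ∈ D → flip a → flip b := fun h h' => hflip h h' hab
    have h6 : b ∈ D → a ∈ D → flip b → flip a := fun h h' => hflip h h' hab.symm
    simp only [Set.mem_ofPred_eq] at ha hb
    clear_value flip D
    clear hkey hright hself hflip
    grind
  refine ⟨_, _, hstable hS hR hmemD, hstable hR hS (fun x => by rw [hmemD]; tauto), ?_, ?_, ?_⟩
  · intro x
    by_cases hf : flip x <;> simp [hf, or_comm, and_comm]
  · intro x hxi hx
    have h1 := hmemD x
    have h2 : x ∈ D → flip x → x ∉ S := fun h hf => by simpa using hright h hxi hf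
    have h3 : x ∈ D → x ∉ S → flip x := fun h hS => hself h (Or.inl ⟨hxi, hS⟩)
    simp only [Set.mem_ofPred_eq] at hx ⊢
    clear_value flip D
    clear hkey hright hself hflip hstable
    grind
  · intro j hj x hxj hx
    have h1 := hmemD x
    have h2 : x ∈ D → flip x → x ∈ S := fun h hf => by simpa [hj] using hright h hxj hf
    have h3 : x ∈ D → x ∈ S → flip x := fun h hS => hself h (Or.inr ⟨j, hj, hxj, hS⟩)
    simp only [Set.mem_ofPred_eq] at hx ⊢
    clear_value flip D
    clear hkey hright hself hflip hstable
    grind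

/-- A point in the convex hull of a finite family is a convex combination of the family. -/
lemma exists_mem_stdSimplex_of_mem_convexHull_range {ι E : Type*} [Fintype ι] [AddCommGroup E]
    [Module ℝ E] {f : ι → E} {x : E} (hx : x ∈ convexHull ℝ (Set.range f)) :
    ∃ w ∈ stdSimplex ℝ ι, ∑ i, w i • f i = x := by
  classical
  have hr : Set.range f =
      Fintype.linearCombination ℝ f '' Set.range fun i : ι => Pi.single i (1 : ℝ) := by
    rw [← Set.range_comp]
    congr 1
    ext i
    simp
  rw [hr, ← LinearMap.image_convexHull, convexHull_rangle_single_eq_stdSimplex] at hx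
  obtain ⟨w, hw, rfl⟩ := hx
  exact ⟨w, hw, (Fintype.linearCombination_apply ℝ f w).symm⟩

/-- Among all probability vectors with prescribed values of some linear functionals, there is one
for which no constraint-preserving exchange of two points of its support decreases the cost. -/
lemma exists_mem_stdSimplex_forall_exchange {P ι : Type*} [Fintype P] (F : ι → P → ℝ) (c : ι → ℝ)
    (d : P → ℝ) (h : ∃ w ∈ stdSimplex ℝ P, ∀ i, ∑ q, w q * F i q = c i) :
    ∃ w ∈ stdSimplex ℝ P, (∀ i, ∑ q, w q * F i q = c i) ∧
      ∀ q q' r r', 0 < w q → 0 < w q' → q ≠ q' → (∀ i, F i r + F i r' = F i q + F i q') →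
        d q + d q' ≤ d r + d r' := by
  classical
  let K : Set (P → ℝ) := stdSimplex ℝ P ∩ {w | ∀ i, ∑ q, w q * F i q = c i}
  have hclosed : IsClosed {w : P → ℝ | ∀ i, ∑ q, w q * F i q = c i} := by
    rw [Set.ofPred_forall]
    exact isClosed_iInter fun i => isClosed_eq (by fun_prop) continuous_const
  have hK : IsCompact K := (isCompact_stdSimplex ℝ P).inter_right hclosed
  obtain ⟨w, ⟨hw, hwc⟩, hmin⟩ := hK.exists_isMinOn h
    (f := fun w => ∑ q, w q * d q) (by fun_prop)
  refine ⟨w, hw, hwc, fun q q' r r' hq hq' hqq hF => ?_⟩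
  set ε := min (w q) (w q')
  have hεpos : 0 < ε := lt_min hq hq'
  let w' : P → ℝ := fun x => w x + ε * ((Pi.single r 1 : P → ℝ) x + (Pi.single r' 1 : P → ℝ) x
    - (Pi.single q 1 : P → ℝ) x - (Pi.single q' 1 : P → ℝ) x)
  have hsum (f : P → ℝ) :
      ∑ x, w' x * f x = ∑ x, w x * f x + ε * (f r + f r' - f q - f q') := by
    simp only [w', add_mul, mul_assoc, Finset.sum_add_distrib, ← Finset.mul_sum, sub_mul,
      Finset.sum_sub_distrib, Pi.single_apply, ite_mul, one_mul, zero_mul, Finset.sum_ite_eq',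
      Finset.mem_univ, if_true]
  have hw' : w' ∈ K := by
    refine ⟨⟨fun x => ?_, ?_⟩, fun i => ?_⟩
    · have h1 : 0 ≤ (Pi.single r 1 : P → ℝ) x := by rw [Pi.single_apply]; split_ifs <;> norm_num
      have h2 : 0 ≤ (Pi.single r' 1 : P → ℝ) x := by rw [Pi.single_apply]; split_ifs <;> norm_num
      have h3 : ε * ((Pi.single q 1 : P → ℝ) x + (Pi.single q' 1 : P → ℝ) x) ≤ w x := by
        simp only [Pi.single_apply]
        split_ifs with h h'
        · exact absurd (h.symm.trans h') hqq
        · rw [h, add_zero, mul_one]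
          exact min_le_left _ _
        · rename_i h'
          rw [h', zero_add, mul_one]
          exact min_le_right _ _
        · simpa using hw.1 x
      have h4 := mul_nonneg hεpos.le (add_nonneg h1 h2)
      simp only [w']
      linarith
    · have := hsum fun _ => 1
      simp only [mul_one] at this
      rw [this, hw.2]
      ring
    · have := hF i
      rw [hsum, hwc i, show F i r + F i r' - F i q - F i q' = 0 by linarith, mul_zero, add_zero]
  have := hmin hw'
  simp only [Set.mem_ofPred_eq, hsum] at this
  have : 0 ≤ d r + d r' - d q - d q' := nonneg_of_mul_nonneg_right (by linarith) hεpos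
  linarith

open scoped Classical in
lemma charVec_apply {V : Type} (S : Set V) (v : V) : charVec S v = if v ∈ S then 1 else 0 := by
  simp [charVec, Set.indicator_apply]

/-- The stable sets of an induced subgraph are the stable sets of the graph contained in its
vertex set. -/
lemma charVec_image_induce {V : Type} (G : SimpleGraph V) (W : Set V) :
    charVec '' {S : Set W | IsStable (G.induce W) S} ⊆
      Set.range fun (S : {S : Set V // S ⊆ W ∧ IsStable G S}) (v : W) => charVec S.1 v := by
  rintro _ ⟨S, hS, rfl⟩
  refine ⟨⟨Subtype.val '' S, ?_, ?_⟩, ?_⟩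
  · rintro _ ⟨a, -, rfl⟩
    exact a.2
  · rintro _ ⟨a, ha, rfl⟩ _ ⟨b, hb, rfl⟩ hab
    exact hS ha hb hab
  · ext v
    classical
    have h : (v : V) ∈ Subtype.val '' S ↔ v ∈ S := Subtype.val_injective.mem_set_image
    change charVec (Subtype.val '' S) (v : V) = charVec S v
    rw [charVec_apply, charVec_apply, if_congr h rfl rfl]

open scoped Classical in
/-- Sorting two pairs of memberships in the same direction does not increase the number of
mismatches. -/
lemma mismatch_add_le_of_sorted {a b c d a' b' c' d' : Prop}
    (hac : (a' ∨ c' ↔ a ∨ c) ∧ (a' ∧ c' ↔ a ∧ c)) (hbd : (b' ∨ d' ↔ b ∨ d) ∧ (b' ∧ d' ↔ b ∧ d))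
    (h : (c' → a') ∧ (d' → b') ∨ (a' → c') ∧ (b' → d')) :
    (if ¬ (a' ↔ b') then 1 else 0 : ℝ) + (if ¬ (c' ↔ d') then 1 else 0) ≤
      (if ¬ (a ↔ b) then 1 else 0) + (if ¬ (c ↔ d) then 1 else 0) := by
  split_ifs <;> first | (norm_num; done) | grind

/-- **Lemma 8.** If `X = V1 ∩ V2` is a harmonious cutset of `G` witnessed by the
separation `(G[V1], G[V2])`, and `z` is a rational vector whose restrictions to `V1`
and `V2` lie in the stable set polytopes of the corresponding induced subgraphs,
then `z` lies in the stable set polytope of `G`. -/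
theorem harmonious_cutset_SSP {V : Type} [Fintype V] (G : SimpleGraph V)
    (V1 V2 : Set V) (hunion : V1 ∪ V2 = Set.univ)
    (h1 : (V1 \ V2).Nonempty) (h2 : (V2 \ V1).Nonempty)
    (hsep : ∀ u ∈ V1 \ V2, ∀ v ∈ V2 \ V1, ¬ G.Adj u v)
    (hharm : ∃ (s : ℕ) (Xp : Fin s → Set V), (⋃ i, Xp i) = V1 ∩ V2 ∧ Harmonious G Xp)
    (z : V → ℚ)
    (hz1 : (fun v : V1 => ((z v : ℚ) : ℝ)) ∈ SSP (G.induce V1))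
    (hz2 : (fun v : V2 => ((z v : ℚ) : ℝ)) ∈ SSP (G.induce V2)) :
    (fun v : V => ((z v : ℚ) : ℝ)) ∈ SSP G := by
  classical
  obtain ⟨s, X, hXU, hX⟩ := hharm
  let P := {S : Set V // S ⊆ V1 ∧ IsStable G S} × {S : Set V // S ⊆ V2 ∧ IsStable G S}
  have : Fintype P := Fintype.ofFinite P
  let d (q : P) : ℝ := ∑ x, if x ∈ V1 ∩ V2 ∧ ¬ (x ∈ q.1.1 ↔ x ∈ q.2.1) then 1 else 0
  let F : V1 ⊕ V2 → P → ℝ :=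
    Sum.elim (fun v q => charVec q.1.1 v) (fun v q => charVec q.2.1 v)
  let c : V1 ⊕ V2 → ℝ := Sum.elim (fun v => z v) (fun v => z v)
  have hstart : ∃ w ∈ stdSimplex ℝ P, ∀ i, ∑ q, w q * F i q = c i := by
    have hmem : ((fun v : V1 => ((z v : ℚ) : ℝ)), (fun v : V2 => ((z v : ℚ) : ℝ))) ∈
        convexHull ℝ (Set.range fun q : P =>
          ((fun v : V1 => charVec q.1.1 v), (fun v : V2 => charVec q.2.1 v))) := by
      refine convexHull_mono ?_ (mk_mem_convexHull_prod hz1 hz2)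
      rintro ⟨a, b⟩ ⟨ha, hb⟩
      obtain ⟨S, rfl⟩ := charVec_image_induce G V1 ha
      obtain ⟨T, rfl⟩ := charVec_image_induce G V2 hb
      exact ⟨(S, T), rfl⟩
    obtain ⟨w, hw, h⟩ := exists_mem_stdSimplex_of_mem_convexHull_range hmem
    rw [Prod.ext_iff, Prod.fst_sum, Prod.snd_sum] at h
    refine ⟨w, hw, ?_⟩
    rintro (v | v)
    · simpa [F, c] using congrFun h.1 v
    · simpa [F, c] using congrFun h.2 v
  obtain ⟨w, hw, hwc, hopt⟩ := exists_mem_stdSimplex_forall_exchange F c d hstart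
  have hz1' (v : V) (hv : v ∈ V1) : ∑ q, w q * charVec q.1.1 v = z v := hwc (Sum.inl ⟨v, hv⟩)
  have hz2' (v : V) (hv : v ∈ V2) : ∑ q, w q * charVec q.2.1 v = z v := hwc (Sum.inr ⟨v, hv⟩)
  have hagree (q : P) (hq : 0 < w q) (v : V) (hv : v ∈ V1 ∩ V2) : v ∈ q.1.1 ↔ v ∈ q.2.1 := by
    by_contra hne
    have hdiff : charVec q.1.1 v - charVec q.2.1 v ≠ 0 := by
      simp only [charVec_apply]
      split_ifs <;> first | tauto | norm_num
    have hpos (a b : P → ℝ) (hab : ∑ q, w q * a q = ∑ q, w q * b q) (h : a q - b q ≠ 0) :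
        ∃ q, 0 < w q ∧ 0 < a q - b q := by
      obtain ⟨q', -, h'⟩ := Finset.exists_pos_of_sum_zero_of_exists_nonzero (s := Finset.univ)
        (fun q => w q * (a q - b q)) (by simp [mul_sub, hab])
        ⟨q, Finset.mem_univ _, mul_ne_zero hq.ne' h⟩
      have h0 : 0 < w q' := (hw.1 q').lt_of_ne fun h => by simp [← h] at h'
      exact ⟨q', h0, pos_of_mul_pos_right h' h0.le⟩
    have hzz := (hz1' v hv.1).trans (hz2' v hv.2).symm
    obtain ⟨q₁, hq₁, h₁⟩ := hpos _ _ hzz hdiff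
    obtain ⟨q₂, hq₂, h₂⟩ := hpos _ _ hzz.symm (by rwa [ne_eq, ← neg_eq_zero, neg_sub])
    have hv₁ : v ∈ q₁.1.1 ∧ v ∉ q₁.2.1 := by
      simp only [charVec_apply] at h₁
      split_ifs at h₁ <;> first | tauto | norm_num at h₁
    have hv₂ : v ∈ q₂.2.1 ∧ v ∉ q₂.1.1 := by
      simp only [charVec_apply] at h₂
      split_ifs at h₂ <;> first | tauto | norm_num at h₂
    obtain ⟨i, hvi⟩ := Set.mem_iUnion.1 (hXU ▸ hv)
    obtain ⟨S, R, hS, hR, hSR, hSRi, hSRj⟩ :=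
      hX.exists_exchange_s10 q₁.1.2.2 q₂.1.2.2 hvi hv₁.1
    obtain ⟨T, U, hT, hU, hTU, hTUi, hTUj⟩ :=
      hX.exists_exchange_s10 q₂.2.2.2 q₁.2.2.2 hvi hv₂.1
    have hSV : S ⊆ V1 := fun x hx => ((hSR x).1.1 (Or.inl hx)).elim (@q₁.1.2.1 x) (@q₂.1.2.1 x)
    have hRV : R ⊆ V1 := fun x hx => ((hSR x).1.1 (Or.inr hx)).elim (@q₁.1.2.1 x) (@q₂.1.2.1 x)
    have hTV : T ⊆ V2 := fun x hx => ((hTU x).1.1 (Or.inl hx)).elim (@q₂.2.2.1 x) (@q₁.2.2.1 x)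
    have hUV : U ⊆ V2 := fun x hx => ((hTU x).1.1 (Or.inr hx)).elim (@q₂.2.2.1 x) (@q₁.2.2.1 x)
    have hadd {A B A' B' : Set V} {x : V}
        (h : (x ∈ A' ∨ x ∈ B' ↔ x ∈ A ∨ x ∈ B) ∧ (x ∈ A' ∧ x ∈ B' ↔ x ∈ A ∧ x ∈ B)) :
        charVec A' x + charVec B' x = charVec A x + charVec B x := by
      clear * - h
      simp only [charVec_apply]
      split_ifs <;> first | (norm_num; done) | grind
    have hle := hopt q₁ q₂ (⟨S, hSV, hS⟩, ⟨T, hTV, hT⟩) (⟨R, hRV, hR⟩, ⟨U, hUV, hU⟩) hq₁ hq₂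
      (by rintro rfl; exact hv₁.2 hv₂.1) (by
        rintro (x | x)
        · exact hadd (hSR x)
        · exact (hadd (hTU x)).trans (add_comm _ _))
    refine hle.not_gt ?_
    simp only [d, ← Finset.sum_add_distrib]
    refine Finset.sum_lt_sum (fun x _ => ?_) ⟨v, Finset.mem_univ _, ?_⟩
    · by_cases hx : x ∈ V1 ∩ V2
      · obtain ⟨j, hxj⟩ := Set.mem_iUnion.1 (hXU ▸ hx)
        have h1 := hSR x
        have h2 := hTU x
        have h3 : (x ∈ R → x ∈ S) ∧ (x ∈ U → x ∈ T) ∨ (x ∈ S → x ∈ R) ∧ (x ∈ T → x ∈ U) := by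
          by_cases hji : j = i
          · subst hji
            exact Or.inl ⟨hSRi x hxj, hTUi x hxj⟩
          · exact Or.inr ⟨hSRj j hji x hxj, hTUj j hji x hxj⟩
        simp only [hx, true_and]
        exact mismatch_add_le_of_sorted h1
          (by rwa [or_comm (a := x ∈ q₁.2.1), and_comm (a := x ∈ q₁.2.1)]) h3
      · simp [hx]
    · have h1 := hSR v
      have h2 := hTU v
      have h3 := hSRi v hvi
      have h4 := hTUi v hvi
      obtain ⟨hvS, hvR⟩ : v ∈ S ∧ v ∉ R := by grind
      obtain ⟨hvT, hvU⟩ : v ∈ T ∧ v ∉ U := by grind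
      simp [hv.1, hv.2, hv₁, hv₂, hvS, hvR, hvT, hvU]
  refine mem_convexHull_of_exists_fintype w
    (fun q => if 0 < w q then charVec (q.1.1 ∪ q.2.1) else charVec ∅) hw.1 hw.2 ?_ ?_
  · intro q
    split_ifs with hq
    · refine ⟨_, ?_, rfl⟩
      have hcross {u v : V} (hu : u ∈ q.1.1) (hv : v ∈ q.2.1) : ¬ G.Adj u v := by
        intro huv
        have hu1 := q.1.2.1 hu
        have hv2 := q.2.2.1 hv
        by_cases hu2 : u ∈ V2
        · exact q.2.2.2 ((hagree q hq u ⟨hu1, hu2⟩).1 hu) hv huv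
        by_cases hv1 : v ∈ V1
        · exact q.1.2.2 hu ((hagree q hq v ⟨hv1, hv2⟩).2 hv) huv
        exact hsep u ⟨hu1, hu2⟩ v ⟨hv2, hv1⟩ huv
      rintro u (hu | hu) v (hv | hv)
      · exact q.1.2.2 hu hv
      · exact hcross hu hv
      · exact fun h => hcross hv hu h.symm
      · exact q.2.2.2 hu hv
    · exact ⟨∅, fun u hu => hu.elim, rfl⟩
  · have hval (q : P) (v : V) {A : Set V}
        (hA : 0 < w q → (v ∈ q.1.1 ∪ q.2.1 ↔ v ∈ A)) :
        w q * (if 0 < w q then charVec (q.1.1 ∪ q.2.1) else charVec ∅) v = w q * charVec A v := by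
      split_ifs with hq
      · simp only [charVec_apply, hA hq]
      · rw [le_antisymm (not_lt.1 hq) (hw.1 q), zero_mul, zero_mul]
    ext v
    simp only [Finset.sum_apply, Pi.smul_apply, smul_eq_mul]
    by_cases hv1 : v ∈ V1
    · rw [← hz1' v hv1]
      refine Finset.sum_congr rfl fun q _ => hval q v fun hq => ⟨?_, Or.inl⟩
      rintro (h | h)
      · exact h
      · exact (hagree q hq v ⟨hv1, q.2.2.1 h⟩).2 h
    · have hv2 : v ∈ V2 := (hunion.symm ▸ Set.mem_univ v : v ∈ V1 ∪ V2).resolve_left hv1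
      rw [← hz2' v hv2]
      refine Finset.sum_congr rfl fun q _ => hval q v fun hq => ⟨?_, Or.inr⟩
      rintro (h | h)
      · exact absurd (q.1.2.1 h) hv1
      · exact h
end

section
/- Let G be a finite simple 𝓕-free graph, let C be a 5-hole of G and let v be a vertex of G not on C that has a neighbour on C. Then either v has exactly two neighbours on C and these two are non-consecutive on C, or v has exactly three neighbours on C and these three are not all consecutive on C. -/
open Finset SimpleGraph

/-- An induced copy of `H` minus its last vertex extends to an induced copy of `H` by a
further vertex with the right adjacencies. -/
theorem hasInducedSubgraph_of_snoc {V : Type} {G : SimpleGraph V} {n : ℕ}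
    {H : SimpleGraph (Fin (n + 1))} (f : Fin n → V) (hf : Function.Injective f)
    (hadj : ∀ a b, G.Adj (f a) (f b) ↔ H.Adj a.castSucc b.castSucc)
    (v : V) (hv : v ∉ Set.range f)
    (hvadj : ∀ a, G.Adj v (f a) ↔ H.Adj (Fin.last n) a.castSucc) :
    HasInducedSubgraph G H := by
  refine ⟨⟨⟨Fin.snoc (α := fun _ => V) f v, Fin.snoc_injective_iff.2 ⟨hf, hv⟩⟩, ?_⟩⟩
  intro a b
  induction a using Fin.lastCases <;> induction b using Fin.lastCases <;>
    simp [hadj, hvadj, G.adj_comm _ v, H.adj_comm _ (Fin.last n)]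

/-- A graph consisting of a 5-cycle on the vertices `0,…,4` and a further vertex is an induced
subgraph as soon as some vertex outside a 5-hole attaches to a rotation of that hole in the
same way. -/
theorem IsFiveHole.hasInducedSubgraph {V : Type} {G : SimpleGraph V} {c : ZMod 5 → V}
    (hc : IsFiveHole G c) {v : V} (hv : v ∉ Set.range c) {H : SimpleGraph (Fin 6)}
    (hH : ∀ a b : Fin 5, H.Adj a.castSucc b.castSucc ↔ (b = a + 1 ∨ a = b + 1))
    (i : ZMod 5)
    (hvadj : ∀ a : Fin 5, G.Adj v (c (i + a.val)) ↔ H.Adj (Fin.last 5) a.castSucc) :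
    HasInducedSubgraph G H := by
  have hinj : Function.Injective fun a : Fin 5 => (a.val : ZMod 5) := by decide
  refine hasInducedSubgraph_of_snoc (fun a : Fin 5 => c (i + a.val))
    (fun a b h => hinj (add_left_cancel (hc.1 h))) ?_ v ?_ hvadj
  · intro a b
    rw [hH, hc.2, add_assoc, add_assoc, add_right_inj, add_right_inj]
    revert a b
    decide
  · rintro ⟨a, rfl⟩
    exact hv ⟨_, rfl⟩

/-- In a `P5`-free graph, a neighbour of a vertex of a 5-hole outside the hole is also adjacent
to one of the next three vertices. -/
theorem IsFiveHole.adj_of_not_hasInducedSubgraph_pathGraph {V : Type} {G : SimpleGraph V}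
    {c : ZMod 5 → V} (hc : IsFiveHole G c) (hP : ¬ HasInducedSubgraph G (pathGraph 5))
    {v : V} (hv : v ∉ Set.range c) (i : ZMod 5) (h : G.Adj v (c i)) :
    G.Adj v (c (i + 1)) ∨ G.Adj v (c (i + 2)) ∨ G.Adj v (c (i + 3)) := by
  by_contra! hn
  let p : Fin 4 → ZMod 5 := ![3, 2, 1, 0]
  refine hP (hasInducedSubgraph_of_snoc (fun a => c (i + p a)) ?_ ?_ v ?_ ?_)
  · have hp : Function.Injective p := by decide
    exact fun a b hab => hp (add_left_cancel (hc.1 hab))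
  · intro a b
    rw [hc.2, add_assoc, add_assoc, add_right_inj, add_right_inj, pathGraph_adj]
    revert a b
    decide
  · rintro ⟨a, rfl⟩
    exact hv ⟨_, rfl⟩
  · intro a
    rw [pathGraph_adj]
    fin_cases a <;> simp [p, h, hn]

/-- A nonempty set of residues modulo 5 that contains, together with any `i`, one of the next
three residues, and that consists neither of three consecutive residues, nor of four, nor of
all five, is a translate of `{0, 2}` or of `{0, 1, 3}`. -/
theorem ZMod.five_finset_eq_translate :
    ∀ S : Finset (ZMod 5), S.Nonempty →
      (∀ i ∈ S, i + 1 ∈ S ∨ i + 2 ∈ S ∨ i + 3 ∈ S) →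
      (∀ i ∈ S, i + 1 ∈ S → i + 2 ∈ S → i + 3 ∈ S ∨ i + 4 ∈ S) →
      (∀ i ∈ S, i + 1 ∈ S → i + 2 ∈ S → i + 3 ∈ S → i + 4 ∈ S) →
      (¬ ∀ i, i ∈ S) →
      (∃ i, S = {i, i + 2}) ∨ ∃ i, S = {i, i + 1, i + 3} := by
  set_option synthInstance.maxSize 1000 in
  decide

/-- **Lemma 11.** In an 𝓕-free graph, a neighbour `v` of a 5-hole `C` (with `v` not on
`C`) has either exactly two neighbours on `C`, which are non-consecutive, or exactly
three neighbours on `C`, which are not all consecutive. -/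
theorem neighbour_types_of_five_hole {V : Type} [Fintype V] (G : SimpleGraph V)
    (hF : FFree G) (c : ZMod 5 → V) (hc : IsFiveHole G c)
    (v : V) (hv : v ∉ Set.range c) (hnb : ∃ i, G.Adj v (c i)) :
    (∃ i : ZMod 5, {j : ZMod 5 | G.Adj v (c j)} = {i, i + 2}) ∨
    (∃ i : ZMod 5, {j : ZMod 5 | G.Adj v (c j)} = {i, i + 1, i + 3}) := by
  obtain ⟨hP, -, hW, -, -, -, hA, hB, -⟩ := hF
  have path := hc.adj_of_not_hasInducedSubgraph_pathGraph hP hv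
  have four_or_five (i) (h0 : G.Adj v (c i)) (h1 : G.Adj v (c (i + 1)))
      (h2 : G.Adj v (c (i + 2))) : G.Adj v (c (i + 3)) ∨ G.Adj v (c (i + 4)) := by
    by_contra! hn
    refine hA (hc.hasInducedSubgraph hv (by simp only [graphA, fromRel_adj]; decide) i ?_)
    intro a
    fin_cases a <;> simp [graphA, h0, h1, h2, hn]
  have five (i) (h0 : G.Adj v (c i)) (h1 : G.Adj v (c (i + 1)))
      (h2 : G.Adj v (c (i + 2))) (h3 : G.Adj v (c (i + 3))) : G.Adj v (c (i + 4)) := by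
    by_contra hn
    refine hB (hc.hasInducedSubgraph hv (by simp only [graphB, fromRel_adj]; decide) i ?_)
    intro a
    fin_cases a <;> simp [graphB, h0, h1, h2, h3, hn]
  have not_all : ¬ ∀ i, G.Adj v (c i) := by
    intro h
    refine hW (hc.hasInducedSubgraph hv (by simp only [wheel, fromRel_adj]; decide) 0 ?_)
    intro a
    fin_cases a <;> simp [wheel, h]
  classical
  have := ZMod.five_finset_eq_translate {j : ZMod 5 | G.Adj v (c j)}
    (by simpa [Finset.Nonempty] using hnb) (by simpa using path) (by simpa using four_or_five)
    (by simpa using five) (by simpa using not_all)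
  simpa [← Finset.coe_inj] using this
end

section
/- Let G be a finite simple 𝓕-free graph, let C be a 5-hole of G, and let u and v be two non-adjacent vertices not on C each of which has precisely three neighbours on C. Then u and v have either all three neighbours on C in common, or exactly two common neighbours on C and these two are non-consecutive on C. -/
open Finset SimpleGraph

theorem IsFiveHole.shift {V : Type} {G : SimpleGraph V} {c : ZMod 5 → V}
    (hc : IsFiveHole G c) (i : ZMod 5) : IsFiveHole G fun j => c (i + j) :=
  ⟨fun _ _ h => add_left_cancel (hc.1 h), fun a b => by
    simp only [hc.2, add_assoc, add_right_inj]⟩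

theorem HasInducedSubgraph.of_injective {V W : Type} {G : SimpleGraph V} {H : SimpleGraph W}
    {f : W → V} (hf : f.Injective) (h : ∀ a b, G.Adj (f a) (f b) ↔ H.Adj a b) :
    HasInducedSubgraph G H :=
  ⟨⟨⟨f, hf⟩, h _ _⟩⟩

theorem hasInducedSubgraph_graphA {V : Type} {G : SimpleGraph V} {c : ZMod 5 → V}
    (hc : IsFiveHole G c) {u : V} (hu : ∀ j, u ≠ c j)
    (h : ∀ j, G.Adj u (c j) ↔ j = 0 ∨ j = 1 ∨ j = 2) : HasInducedSubgraph G graphA := by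
  have hu' : ∀ j, c j ≠ u := fun j => (hu j).symm
  have h' : ∀ j, G.Adj (c j) u ↔ j = 0 ∨ j = 1 ∨ j = 2 := fun j => by rw [G.adj_comm, h]
  refine .of_injective (f := ![c 0, c 1, c 2, c 3, c 4, u]) ?_ ?_
  · intro a b
    fin_cases a <;> fin_cases b <;> simp [hc.1.eq_iff, hu, hu'] <;> decide
  · intro a b
    fin_cases a <;> fin_cases b <;> simp [graphA, hc.2, h, h'] <;> decide

theorem hasInducedSubgraph_pathGraph_five {V : Type} {G : SimpleGraph V} {c : ZMod 5 → V}
    (hc : IsFiveHole G c) {u v : V} (hu : ∀ j, u ≠ c j) (hv : ∀ j, v ≠ c j)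
    (hne : u ≠ v) (hnadj : ¬ G.Adj u v)
    (h : ∀ j, G.Adj u (c j) ↔ j = 0 ∨ j = 1 ∨ j = 3)
    (k : ∀ j, G.Adj v (c j) ↔ j = 1 ∨ j = 2 ∨ j = 4) :
    HasInducedSubgraph G (pathGraph 5) := by
  have hu' : ∀ j, c j ≠ u := fun j => (hu j).symm
  have hv' : ∀ j, c j ≠ v := fun j => (hv j).symm
  have hnadj' : ¬ G.Adj v u := fun e => hnadj e.symm
  have h' : ∀ j, G.Adj (c j) u ↔ j = 0 ∨ j = 1 ∨ j = 3 := fun j => by rw [G.adj_comm, h]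
  have k' : ∀ j, G.Adj (c j) v ↔ j = 1 ∨ j = 2 ∨ j = 4 := fun j => by rw [G.adj_comm, k]
  refine .of_injective (f := ![c 0, u, c 3, c 2, v]) ?_ ?_
  · intro a b
    fin_cases a <;> fin_cases b <;> simp [hc.1.eq_iff, hu, hu', hv, hv', hne, hne.symm] <;> decide
  · intro a b
    fin_cases a <;> fin_cases b <;>
      simp [pathGraph_adj, hc.2, h, h', k, k', hnadj, hnadj'] <;> decide

theorem Finset.eq_of_card_eq_three_zmod_five : ∀ A : Finset (ZMod 5), A.card = 3 →
    (∃ i, A = {i, i + 1, i + 2}) ∨ ∃ i, A = {i, i + 1, i + 3} := by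
  decide

/-- If `graphA` is excluded, three neighbours on a 5-hole are never consecutive. -/
theorem IsFiveHole.exists_neighbours_eq {V : Type} {G : SimpleGraph V}
    (hA : ¬ HasInducedSubgraph G graphA) {c : ZMod 5 → V} (hc : IsFiveHole G c) {u : V}
    (hu : ∀ j, u ≠ c j) (h3 : {j : ZMod 5 | G.Adj u (c j)}.ncard = 3) :
    ∃ i, {j : ZMod 5 | G.Adj u (c j)} = {i, i + 1, i + 3} := by
  classical
  have hcard : (univ.filter fun j : ZMod 5 => G.Adj u (c j)).card = 3 := by
    rw [← h3, ← Set.ncard_coe_finset]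
    simp
  rcases Finset.eq_of_card_eq_three_zmod_five _ hcard with ⟨i, hi⟩ | ⟨i, hi⟩
  · refine (hA (hasInducedSubgraph_graphA (hc.shift i) (fun j => hu _) fun j => ?_)).elim
    simpa [add_assoc] using Finset.ext_iff.1 hi (i + j)
  · refine ⟨i, Set.ext fun j => ?_⟩
    simpa using Finset.ext_iff.1 hi j

theorem IsFiveHole.not_neighbours_shift {V : Type} {G : SimpleGraph V}
    (hP : ¬ HasInducedSubgraph G (pathGraph 5)) {c : ZMod 5 → V} (hc : IsFiveHole G c)
    {u v : V} (hu : ∀ j, u ≠ c j) (hv : ∀ j, v ≠ c j) (hne : u ≠ v) (hnadj : ¬ G.Adj u v)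
    {i : ZMod 5} (h : {j : ZMod 5 | G.Adj u (c j)} = {i, i + 1, i + 3}) :
    {j : ZMod 5 | G.Adj v (c j)} ≠ {i + 1, i + 1 + 1, i + 1 + 3} := by
  intro k
  refine hP (hasInducedSubgraph_pathGraph_five (hc.shift i) (fun j => hu _) (fun j => hv _)
    hne hnadj (fun j => ?_) fun j => ?_)
  · simpa using Set.ext_iff.1 h (i + j)
  · have e := Set.ext_iff.1 k (i + j)
    simp only [Set.mem_ofPred_eq, Set.mem_insert_iff, Set.mem_singleton_iff, add_assoc,
      add_right_inj] at e
    exact e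

/-- **Lemma 12.** In an 𝓕-free graph, two non-adjacent vertices off a 5-hole `C`, each
with precisely three neighbours on `C`, have either all three or exactly two
non-consecutive neighbours on `C` in common. -/
theorem two_nonadjacent_three_neighbours {V : Type} [Fintype V] (G : SimpleGraph V)
    (hF : FFree G) (c : ZMod 5 → V) (hc : IsFiveHole G c)
    (u v : V) (hu : u ∉ Set.range c) (hv : v ∉ Set.range c)
    (hne : u ≠ v) (hnadj : ¬ G.Adj u v)
    (hu3 : {j : ZMod 5 | G.Adj u (c j)}.ncard = 3)
    (hv3 : {j : ZMod 5 | G.Adj v (c j)}.ncard = 3) :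
    {j : ZMod 5 | G.Adj u (c j)} = {j : ZMod 5 | G.Adj v (c j)} ∨
    (∃ i : ZMod 5,
      {j : ZMod 5 | G.Adj u (c j)} ∩ {j : ZMod 5 | G.Adj v (c j)} = {i, i + 2}) := by
  have hu' : ∀ j, u ≠ c j := fun j e => hu ⟨j, e.symm⟩
  have hv' : ∀ j, v ≠ c j := fun j e => hv ⟨j, e.symm⟩
  have hP := hF.1
  have hA : ¬ HasInducedSubgraph G graphA := hF.2.2.2.2.2.2.1
  obtain ⟨i, hi⟩ := hc.exists_neighbours_eq hA hu' hu3
  obtain ⟨j, hj⟩ := hc.exists_neighbours_eq hA hv' hv3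
  have h₁ : j ≠ i + 1 := by
    rintro rfl
    exact hc.not_neighbours_shift hP hu' hv' hne hnadj hi hj
  have h₂ : i ≠ j + 1 := by
    rintro rfl
    exact hc.not_neighbours_shift hP hv' hu' hne.symm (fun e => hnadj e.symm) hj hi
  have key : ∀ i j : ZMod 5, j ≠ i + 1 → i ≠ j + 1 → i = j ∨ ∃ k, ∀ x,
      (x = i ∨ x = i + 1 ∨ x = i + 3) ∧ (x = j ∨ x = j + 1 ∨ x = j + 3) ↔
        x = k ∨ x = k + 2 := by
    decide
  rw [hi, hj]
  rcases key i j h₁ h₂ with rfl | ⟨k, hk⟩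
  · exact Or.inl rfl
  · exact Or.inr ⟨k, Set.ext hk⟩
end

section
/- Let G be a finite simple 𝓕-free graph. Then either every 5-hole of G is dominating (i.e. every vertex of G not on the 5-hole has a neighbour on it), or G contains a harmonious cutset. -/
open Finset SimpleGraph

/-- Five vertices spanning an induced 5-cycle, listed in cyclic order. -/
def Hole {V : Type} (G : SimpleGraph V) (a b c d e : V) : Prop :=
  G.Adj a b ∧ G.Adj b c ∧ G.Adj c d ∧ G.Adj d e ∧ G.Adj e a ∧
  ¬ G.Adj a c ∧ ¬ G.Adj b d ∧ ¬ G.Adj c e ∧ ¬ G.Adj d a ∧ ¬ G.Adj e b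

section

variable {V : Type} {G : SimpleGraph V}

/-- Adjacency of pairs `i < j` suffices to recognize an induced subgraph without twins. -/
theorem hasInducedSubgraph_of_lt {n : ℕ} {H : SimpleGraph (Fin n)} (f : Fin n → V)
    (twin : ∀ i j, (∀ k, H.Adj i k ↔ H.Adj j k) → i = j)
    (hf : ∀ i j, i < j → (G.Adj (f i) (f j) ↔ H.Adj i j)) : HasInducedSubgraph G H := by
  have key : ∀ i j, G.Adj (f i) (f j) ↔ H.Adj i j := fun i j => by
    rcases lt_trichotomy i j with h | rfl | h
    · exact hf i j h
    · simp
    · rw [G.adj_comm, H.adj_comm, hf j i h]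
  exact ⟨⟨⟨f, fun i j h => twin i j fun k => by rw [← key, ← key, h]⟩, key _ _⟩⟩

theorem FFree.not_path (hF : FFree G) {a b c d e : V} (h1 : G.Adj a b) (h2 : G.Adj b c)
    (h3 : G.Adj c d) (h4 : G.Adj d e) (h5 : ¬ G.Adj a c) (h6 : ¬ G.Adj a d)
    (h7 : ¬ G.Adj a e) (h8 : ¬ G.Adj b d) (h9 : ¬ G.Adj b e) (h10 : ¬ G.Adj c e) : False := by
  refine hF.1 (hasInducedSubgraph_of_lt ![a, b, c, d, e] ?_ ?_)
  · simp only [pathGraph_adj]; decide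
  · simp [Fin.forall_fin_succ, pathGraph_adj, *]

theorem FFree.not_clique (hF : FFree G) {a b c d : V} (h1 : G.Adj a b) (h2 : G.Adj a c)
    (h3 : G.Adj a d) (h4 : G.Adj b c) (h5 : G.Adj b d) (h6 : G.Adj c d) : False := by
  refine hF.2.1 (hasInducedSubgraph_of_lt ![a, b, c, d] ?_ ?_)
  · simp only [top_adj]; decide
  · simp [Fin.forall_fin_succ, *]

theorem Hole.not_wheel (hF : FFree G) {a b c d e v : V} (h : Hole G a b c d e)
    (ha : G.Adj v a) (hb : G.Adj v b) (hc : G.Adj v c) (hd : G.Adj v d) (he : G.Adj v e) :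
    False := by
  obtain ⟨h1, h2, h3, h4, h5, h6, h7, h8, h9, h10⟩ := h
  refine hF.2.2.1 (hasInducedSubgraph_of_lt ![a, b, c, d, e, v] ?_ ?_)
  · simp only [wheel, fromRel_adj]; decide
  · simp [Fin.forall_fin_succ, wheel, *]
    grind [SimpleGraph.adj_comm]

theorem Hole.not_graphA (hF : FFree G) {a b c d e v : V} (h : Hole G a b c d e)
    (ha : G.Adj v a) (hb : G.Adj v b) (hc : G.Adj v c) (hd : ¬ G.Adj v d)
    (he : ¬ G.Adj v e) : False := by
  obtain ⟨h1, h2, h3, h4, h5, h6, h7, h8, h9, h10⟩ := h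
  refine hF.2.2.2.2.2.2.1 (hasInducedSubgraph_of_lt ![a, b, c, d, e, v] ?_ ?_)
  · simp only [graphA, fromRel_adj]; decide
  · simp [Fin.forall_fin_succ, graphA, *]
    grind [SimpleGraph.adj_comm]

set_option synthInstance.maxHeartbeats 400000 in
set_option synthInstance.maxSize 4096 in
theorem Hole.not_graphB (hF : FFree G) {a b c d e v : V} (h : Hole G a b c d e)
    (ha : G.Adj v a) (hb : G.Adj v b) (hc : G.Adj v c) (hd : G.Adj v d)
    (he : ¬ G.Adj v e) : False := by
  obtain ⟨h1, h2, h3, h4, h5, h6, h7, h8, h9, h10⟩ := h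
  refine hF.2.2.2.2.2.2.2.1 (hasInducedSubgraph_of_lt ![a, b, c, d, e, v] ?_ ?_)
  · simp only [graphB, fromRel_adj]; decide
  · simp [Fin.forall_fin_succ, graphB, *]
    grind [SimpleGraph.adj_comm]

/-- `v` sees exactly `a`, `c`, `d` on the hole `a b c d e`. -/
def Triad (G : SimpleGraph V) (a b c d e v : V) : Prop :=
  G.Adj v a ∧ ¬ G.Adj v b ∧ G.Adj v c ∧ G.Adj v d ∧ ¬ G.Adj v e

set_option synthInstance.maxHeartbeats 400000 in
set_option synthInstance.maxSize 4096 in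
theorem Hole.triad_adj_of_dist_two (hF : FFree G) {a b c d e u v x : V}
    (h : Hole G a b c d e) (hu : Triad G a b c d e u) (hv : Triad G c d e a b v)
    (hxa : ¬ G.Adj x a) (hxb : ¬ G.Adj x b) (hxc : ¬ G.Adj x c) (hxd : ¬ G.Adj x d)
    (hxe : ¬ G.Adj x e) (hxu : G.Adj u x) (hxv : G.Adj v x) : G.Adj u v := by
  by_contra huv
  obtain ⟨h1, h2, h3, h4, h5, h6, h7, h8, h9, h10⟩ := h
  obtain ⟨u1, u2, u3, u4, u5⟩ := hu
  obtain ⟨v1, v2, v3, v4, v5⟩ := hv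
  refine hF.2.2.2.2.2.2.2.2 (hasInducedSubgraph_of_lt ![d, c, b, a, e, u, v, x] ?_ ?_)
  · simp only [graphC, fromRel_adj]; decide
  · simp [Fin.forall_fin_succ, graphC, *]
    grind [SimpleGraph.adj_comm]

theorem Hole.rotate {a b c d e : V} (h : Hole G a b c d e) : Hole G b c d e a := by
  unfold Hole at *
  tauto

/-- The neighbours of a vertex on a 5-hole are neither a single vertex nor two consecutive
ones. -/
theorem Hole.not_pendant (hF : FFree G) {a b c d e v : V} (h : Hole G a b c d e)
    (ha : G.Adj v a) (hc : ¬ G.Adj v c) (hd : ¬ G.Adj v d) (he : ¬ G.Adj v e) : False := by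
  obtain ⟨h1, h2, h3, h4, h5, h6, h7, h8, h9, h10⟩ := h
  by_cases hb : G.Adj v b
  · exact hF.not_path hb h2 h3 h4 hc hd he h7 (fun h => h10 h.symm) h8
  · exact hF.not_path ha h1 h2 h3 hb hc hd h6 (fun h => h9 h.symm) h7

/-- The neighbourhood of a vertex on a 5-hole. -/
theorem Hole.trichotomy (hF : FFree G) {a b c d e : V} (h : Hole G a b c d e) (v : V) :
    (¬ G.Adj v a ∧ ¬ G.Adj v b ∧ ¬ G.Adj v c ∧ ¬ G.Adj v d ∧ ¬ G.Adj v e) ∨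
    ((¬ G.Adj v a ∧ G.Adj v b ∧ ¬ G.Adj v c ∧ ¬ G.Adj v d ∧ G.Adj v e) ∨
     (¬ G.Adj v b ∧ G.Adj v c ∧ ¬ G.Adj v d ∧ ¬ G.Adj v e ∧ G.Adj v a) ∨
     (¬ G.Adj v c ∧ G.Adj v d ∧ ¬ G.Adj v e ∧ ¬ G.Adj v a ∧ G.Adj v b) ∨
     (¬ G.Adj v d ∧ G.Adj v e ∧ ¬ G.Adj v a ∧ ¬ G.Adj v b ∧ G.Adj v c) ∨
     (¬ G.Adj v e ∧ G.Adj v a ∧ ¬ G.Adj v b ∧ ¬ G.Adj v c ∧ G.Adj v d)) ∨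
    (Triad G a b c d e v ∨ Triad G b c d e a v ∨ Triad G c d e a b v ∨ Triad G d e a b c v ∨
      Triad G e a b c d v) := by
  have r0 := h
  have r1 := r0.rotate
  have r2 := r1.rotate
  have r3 := r2.rotate
  have r4 := r3.rotate
  have p0 := r0.not_pendant hF (v := v)
  have p1 := r1.not_pendant hF (v := v)
  have p2 := r2.not_pendant hF (v := v)
  have p3 := r3.not_pendant hF (v := v)
  have p4 := r4.not_pendant hF (v := v)
  have a0 := r0.not_graphA hF (v := v)
  have a1 := r1.not_graphA hF (v := v)
  have a2 := r2.not_graphA hF (v := v)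
  have a3 := r3.not_graphA hF (v := v)
  have a4 := r4.not_graphA hF (v := v)
  have b0 := r0.not_graphB hF (v := v)
  have b1 := r1.not_graphB hF (v := v)
  have b2 := r2.not_graphB hF (v := v)
  have b3 := r3.not_graphB hF (v := v)
  have b4 := r4.not_graphB hF (v := v)
  have w := r0.not_wheel hF (v := v)
  clear r0 r1 r2 r3 r4 h hF
  unfold Triad
  generalize G.Adj v a = A, G.Adj v b = B, G.Adj v c = C, G.Adj v d = D, G.Adj v e = E at *
  by_cases A <;> by_cases B <;> by_cases C <;> by_cases D <;> by_cases E <;> grind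

/-- A vertex with a neighbour on the hole and a neighbour far from it is a triad. -/
theorem Hole.triad_of_adj (hF : FFree G) {a b c d e v y : V} (h : Hole G a b c d e)
    (hya : ¬ G.Adj y a) (hyb : ¬ G.Adj y b) (hyc : ¬ G.Adj y c) (hyd : ¬ G.Adj y d)
    (hye : ¬ G.Adj y e) (hvy : G.Adj y v)
    (hv : ¬ (¬ G.Adj v a ∧ ¬ G.Adj v b ∧ ¬ G.Adj v c ∧ ¬ G.Adj v d ∧ ¬ G.Adj v e)) :
    Triad G a b c d e v ∨ Triad G b c d e a v ∨ Triad G c d e a b v ∨ Triad G d e a b c v ∨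
      Triad G e a b c d v := by
  have far {b c d : V} (hbc : G.Adj b c) (hcd : G.Adj c d) (hbd : ¬ G.Adj b d)
      (hyb : ¬ G.Adj y b) (hyc : ¬ G.Adj y c) (hyd : ¬ G.Adj y d) (hvb : G.Adj v b)
      (hvc : ¬ G.Adj v c) (hvd : ¬ G.Adj v d) : False :=
    hF.not_path hvy hvb hbc hcd hyb hyc hyd hvc hvd hbd
  have ht := h.trichotomy hF v
  obtain ⟨h1, h2, h3, h4, h5, h6, h7, h8, h9, h10⟩ := h
  rcases ht with ht | ht | ht
  · exact absurd ht hv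
  · exfalso
    rcases ht with ⟨t1, t2, t3, t4, t5⟩ | ⟨t1, t2, t3, t4, t5⟩ | ⟨t1, t2, t3, t4, t5⟩ |
      ⟨t1, t2, t3, t4, t5⟩ | ⟨t1, t2, t3, t4, t5⟩
    · exact far h2 h3 h7 hyb hyc hyd t2 t3 t4
    · exact far h3 h4 h8 hyc hyd hye t2 t3 t4
    · exact far h4 h5 h9 hyd hye hya t2 t3 t4
    · exact far h5 h1 h10 hye hya hyb t2 t3 t4
    · exact far h1 h2 h6 hya hyb hyc t2 t3 t4
  · exact ht

/-- Adjacent vertices far from a hole see the same vertices that have neighbours on it. -/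
theorem Hole.adj_of_adj (hF : FFree G) {a b c d e v y z : V} (h : Hole G a b c d e)
    (hy : ¬ G.Adj y a ∧ ¬ G.Adj y b ∧ ¬ G.Adj y c ∧ ¬ G.Adj y d ∧ ¬ G.Adj y e)
    (hz : ¬ G.Adj z a ∧ ¬ G.Adj z b ∧ ¬ G.Adj z c ∧ ¬ G.Adj z d ∧ ¬ G.Adj z e)
    (hv : ¬ (¬ G.Adj v a ∧ ¬ G.Adj v b ∧ ¬ G.Adj v c ∧ ¬ G.Adj v d ∧ ¬ G.Adj v e))
    (hvy : G.Adj v y) (hyz : G.Adj y z) : G.Adj v z := by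
  by_contra hvz
  have ht := h.triad_of_adj hF hy.1 hy.2.1 hy.2.2.1 hy.2.2.2.1 hy.2.2.2.2 hvy.symm hv
  have far {a b : V} (hab : G.Adj a b) (hya : ¬ G.Adj y a) (hyb : ¬ G.Adj y b)
      (hza : ¬ G.Adj z a) (hzb : ¬ G.Adj z b) (hva : G.Adj v a) (hvb : ¬ G.Adj v b) : False :=
    hF.not_path hyz.symm hvy.symm hva hab (fun h => hvz h.symm) hza hzb hya hyb hvb
  obtain ⟨h1, h2, h3, h4, h5, -⟩ := h
  obtain ⟨y1, y2, y3, y4, y5⟩ := hy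
  obtain ⟨z1, z2, z3, z4, z5⟩ := hz
  rcases ht with t | t | t | t | t
  · exact far h1 y1 y2 z1 z2 t.1 t.2.1
  · exact far h2 y2 y3 z2 z3 t.1 t.2.1
  · exact far h3 y3 y4 z3 z4 t.1 t.2.1
  · exact far h4 y4 y5 z4 z5 t.1 t.2.1
  · exact far h5 y5 y1 z5 z1 t.1 t.2.1

theorem Hole.triad_adj_of_dist_one (hF : FFree G) {a b c d e u v x : V}
    (h : Hole G a b c d e) (hu : Triad G a b c d e u) (hv : Triad G b c d e a v)
    (hxc : ¬ G.Adj x c) (hxe : ¬ G.Adj x e) (hxu : G.Adj u x) (hxv : G.Adj v x) :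
    G.Adj u v := by
  by_contra huv
  obtain ⟨h1, h2, h3, h4, h5, h6, h7, h8, h9, h10⟩ := h
  obtain ⟨u1, u2, u3, u4, u5⟩ := hu
  obtain ⟨v1, v2, v3, v4, v5⟩ := hv
  exact hF.not_path u3.symm hxu hxv.symm v4 (fun h => hxc h.symm) (fun h => v2 h.symm) h8 huv u5
    hxe

theorem Hole.not_adj_of_triad (hF : FFree G) {a b c d e u v : V} (h : Hole G a b c d e)
    (hu : Triad G a b c d e u) (hv : Triad G a b c d e v) : ¬ G.Adj u v := fun huv =>
  hF.not_clique huv hu.2.2.1 hu.2.2.2.1 hv.2.2.1 hv.2.2.2.1 h.2.2.1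

/-- Two triads of the same kind attached to `x` see the same neighbours of `x` that have
neighbours on the hole. -/
theorem Hole.triad_adj_iff (hF : FFree G) {a b c d e u v p x : V} (h : Hole G a b c d e)
    (hu : Triad G a b c d e u) (hv : Triad G a b c d e v)
    (hx : ¬ G.Adj x a ∧ ¬ G.Adj x b ∧ ¬ G.Adj x c ∧ ¬ G.Adj x d ∧ ¬ G.Adj x e)
    (hxu : G.Adj u x) (hxv : G.Adj v x) (hxp : G.Adj p x)
    (hp : ¬ (¬ G.Adj p a ∧ ¬ G.Adj p b ∧ ¬ G.Adj p c ∧ ¬ G.Adj p d ∧ ¬ G.Adj p e)) :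
    G.Adj u p ↔ G.Adj v p := by
  obtain ⟨x1, x2, x3, x4, x5⟩ := hx
  rcases h.triad_of_adj hF x1 x2 x3 x4 x5 hxp.symm hp with t | t | t | t | t
  · exact iff_of_false (h.not_adj_of_triad hF hu t) (h.not_adj_of_triad hF hv t)
  · exact iff_of_true (h.triad_adj_of_dist_one hF hu t x3 x5 hxu hxp)
      (h.triad_adj_of_dist_one hF hv t x3 x5 hxv hxp)
  · exact iff_of_true (h.triad_adj_of_dist_two hF hu t x1 x2 x3 x4 x5 hxu hxp)
      (h.triad_adj_of_dist_two hF hv t x1 x2 x3 x4 x5 hxv hxp)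
  · have h' := h.rotate.rotate.rotate
    exact iff_of_true (h'.triad_adj_of_dist_two hF t hu x4 x5 x1 x2 x3 hxp hxu).symm
      (h'.triad_adj_of_dist_two hF t hv x4 x5 x1 x2 x3 hxp hxv).symm
  · have h' := h.rotate.rotate.rotate.rotate
    exact iff_of_true (h'.triad_adj_of_dist_one hF t hu x2 x4 hxp hxu).symm
      (h'.triad_adj_of_dist_one hF t hv x2 x4 hxp hxv).symm

/-- Two triads of the same kind attached to `x` are not joined by an induced path of length
three. -/
theorem Hole.no_path_of_triad (hF : FFree G) {a b c d e u v p q x : V} (h : Hole G a b c d e)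
    (hu : Triad G a b c d e u) (hv : Triad G a b c d e v)
    (hx : ¬ G.Adj x a ∧ ¬ G.Adj x b ∧ ¬ G.Adj x c ∧ ¬ G.Adj x d ∧ ¬ G.Adj x e)
    (hxu : G.Adj u x) (hxv : G.Adj v x) (hup : G.Adj u p) (hpq : G.Adj p q) (hqv : G.Adj q v)
    (huq : ¬ G.Adj u q) (hpv : ¬ G.Adj p v) : False := by
  have hua : ¬ (¬ G.Adj u a ∧ ¬ G.Adj u b ∧ ¬ G.Adj u c ∧ ¬ G.Adj u d ∧ ¬ G.Adj u e) :=
    fun hh => hh.1 hu.1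
  have hva : ¬ (¬ G.Adj v a ∧ ¬ G.Adj v b ∧ ¬ G.Adj v c ∧ ¬ G.Adj v d ∧ ¬ G.Adj v e) :=
    fun hh => hh.1 hv.1
  have hxp : ¬ G.Adj x p := fun hxp => by
    by_cases hp : ¬ G.Adj p a ∧ ¬ G.Adj p b ∧ ¬ G.Adj p c ∧ ¬ G.Adj p d ∧ ¬ G.Adj p e
    · exact hpv (h.adj_of_adj hF hx hp hva hxv hxp).symm
    · exact hpv ((h.triad_adj_iff hF hu hv hx hxu hxv hxp.symm hp).1 hup).symm
  have hxq : ¬ G.Adj x q := fun hxq => by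
    by_cases hq : ¬ G.Adj q a ∧ ¬ G.Adj q b ∧ ¬ G.Adj q c ∧ ¬ G.Adj q d ∧ ¬ G.Adj q e
    · exact huq (h.adj_of_adj hF hx hq hua hxu hxq)
    · exact huq ((h.triad_adj_iff hF hu hv hx hxu hxv hxq.symm hq).2 hqv.symm)
  have huv := h.not_adj_of_triad hF hu hv
  have h' : Hole G x u p q v :=
    ⟨hxu.symm, hup, hpq, hqv, hxv, hxp, huq, hpv, fun h => hxq h.symm, fun h => huv h.symm⟩
  have not_clique {r : V} {w : V} (hw : Triad G a b c d e w) (hwr : G.Adj w r) (hrc : G.Adj r c)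
      (hrd : G.Adj r d) : False :=
    hF.not_clique hwr hw.2.2.1 hw.2.2.2.1 hrc hrd h.2.2.1
  have propagate {r s w : V} (hrs : G.Adj r s) (hw : Triad G a b c d e w) (hwr : G.Adj w r)
      (hws : ¬ G.Adj w s)
      (hr : ¬ G.Adj r a ∧ ¬ G.Adj r b ∧ ¬ G.Adj r c ∧ ¬ G.Adj r d ∧ ¬ G.Adj r e)
      {w' : V} (hw' : Triad G a b c d e w') (hws' : G.Adj w' s)
      (hsb : ¬ G.Adj s b) (hse : ¬ G.Adj s e) : False := by
    by_cases hs : ¬ G.Adj s a ∧ ¬ G.Adj s b ∧ ¬ G.Adj s c ∧ ¬ G.Adj s d ∧ ¬ G.Adj s e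
    · exact hws (h.adj_of_adj hF hr hs (fun hh => hh.1 hw.1) hwr hrs)
    · rcases h.triad_of_adj hF hr.1 hr.2.1 hr.2.2.1 hr.2.2.2.1 hr.2.2.2.2 hrs hs with
        t | t | t | t | t
      · exact not_clique hw' hws' t.2.2.1 t.2.2.2.1
      · exact hsb t.1
      · exact hse t.2.2.1
      · exact hsb t.2.2.2.1
      · exact hse t.1
  have outer {w : V} (hwx : ¬ G.Adj w x) (hwu : ¬ G.Adj w u) (hwv : ¬ G.Adj w v) :
      ¬ G.Adj w p ∧ ¬ G.Adj w q := by
    have hwp : ¬ G.Adj w p := fun hwp => h'.rotate.rotate.not_pendant hF hwp hwv hwx hwu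
    exact ⟨hwp, fun hwq => h'.rotate.rotate.rotate.not_pendant hF hwq hwx hwu hwp⟩
  have hb := outer (fun h => hx.2.1 h.symm) (fun h => hu.2.1 h.symm) (fun h => hv.2.1 h.symm)
  have he := outer (fun h => hx.2.2.2.2 h.symm) (fun h => hu.2.2.2.2 h.symm)
    (fun h => hv.2.2.2.2 h.symm)
  have ha : ¬ (G.Adj a p ∧ G.Adj a q) := fun ha =>
    h'.rotate.not_graphB hF hu.1.symm ha.1 ha.2 hv.1.symm (fun h => hx.1 h.symm)
  have far {r w : V} (hw : Triad G a b c d e w) (hwr : G.Adj w r) (hra : ¬ G.Adj a r)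
      (hrb : ¬ G.Adj b r) (hre : ¬ G.Adj e r) :
      ¬ G.Adj r a ∧ ¬ G.Adj r b ∧ ¬ G.Adj r c ∧ ¬ G.Adj r d ∧ ¬ G.Adj r e := by
    rw [G.adj_comm] at hra hrb hre
    have hrc : ¬ G.Adj r c := fun hrc => by
      by_cases hrd : G.Adj r d
      · exact not_clique hw hwr hrc hrd
      · exact h.rotate.rotate.not_pendant hF hrc hre hra hrb
    exact ⟨hra, hrb, hrc, fun hrd => h.rotate.rotate.rotate.not_pendant hF hrd hra hrb hrc, hre⟩
  rw [not_and_or] at ha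
  rcases ha with ha | ha
  · exact propagate hpq hu hup huq (far hu hup ha hb.1 he.1) hv hqv.symm
      (fun h => hb.2 h.symm) (fun h => he.2 h.symm)
  · exact propagate hpq.symm hv hqv.symm (fun h => hpv h.symm) (far hv hqv.symm ha hb.2 he.2) hu hup
      (fun h => hb.1 h.symm) (fun h => he.1 h.symm)

theorem IsInducedPath.adj_getVert_iff {u v : V} {p : G.Walk u v} (hp : IsInducedPath G p)
    {i j : ℕ} (hij : i < j) (hj : j ≤ p.length) :
    G.Adj (p.getVert i) (p.getVert j) ↔ j = i + 1 := by
  constructor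
  · intro h
    have hm (k : ℕ) : p.getVert k ∈ p.toSubgraph.verts :=
      p.mem_verts_toSubgraph.2 (p.getVert_mem_support k)
    obtain ⟨k, hk, hkl⟩ := p.toSubgraph_adj_iff.1 (hp.2 (hm i) (hm j) h)
    have inj {m n : ℕ} (hm : m ≤ p.length) (hn : n ≤ p.length)
        (he : p.getVert m = p.getVert n) : m = n := hp.1.getVert_injOn hm hn he
    rcases Sym2.eq_iff.1 hk with ⟨h1, h2⟩ | ⟨h1, h2⟩
    · have := inj (by omega) (by omega) h1
      have := inj (by omega) (by omega) h2
      omega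
    · have := inj (by omega) (by omega) h1
      have := inj (by omega) (by omega) h2
      omega
  · rintro rfl
    exact p.adj_getVert_succ hj

theorem IsInducedPath.length_le_three (hF : FFree G) {u v : V} {p : G.Walk u v}
    (hp : IsInducedPath G p) : p.length ≤ 3 := by
  by_contra! hl
  have adj {i j : ℕ} (hij : i < j) (hj : j ≤ 4) := hp.adj_getVert_iff hij (hj.trans hl)
  refine hF.not_path (a := p.getVert 0) (b := p.getVert 1) (c := p.getVert 2)
    (d := p.getVert 3) (e := p.getVert 4) ?_ ?_ ?_ ?_ ?_ ?_ ?_ ?_ ?_ ?_ <;>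
  rw [adj] <;> omega

theorem IsFiveHole.hole {c : ZMod 5 → V} (hc : IsFiveHole G c) (i : ZMod 5) :
    Hole G (c i) (c (i + 1)) (c (i + 2)) (c (i + 3)) (c (i + 4)) := by
  unfold Hole
  simp only [hc.2]
  revert i
  decide

/-- The vertices attached to `x` that see `c i`, `c (i + 2)`, `c (i + 3)` on the 5-hole `c`. -/
def triadSet (G : SimpleGraph V) (c : ZMod 5 → V) (x : V) (i : ZMod 5) : Set V :=
  {v | G.Adj v x ∧ Triad G (c i) (c (i + 1)) (c (i + 2)) (c (i + 3)) (c (i + 4)) v}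

theorem IsFiveHole.triadSet_adj (hF : FFree G) {c : ZMod 5 → V} (hc : IsFiveHole G c) {x : V}
    (hx : ∀ i, ¬ G.Adj x (c i)) {i j : ZMod 5} (hij : i ≠ j) {u v : V}
    (hu : u ∈ triadSet G c x i) (hv : v ∈ triadSet G c x j) : G.Adj u v := by
  have one {i : ZMod 5} {u v : V} (hu : u ∈ triadSet G c x i)
      (hv : v ∈ triadSet G c x (i + 1)) : G.Adj u v := by
    have e : i + 1 + 1 = i + 2 ∧ i + 1 + 2 = i + 3 ∧ i + 1 + 3 = i + 4 ∧ i + 1 + 4 = i := by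
      clear hu hv
      revert i
      decide
    have hv' := hv.2
    rw [e.1, e.2.1, e.2.2.1, e.2.2.2] at hv'
    exact (hc.hole i).triad_adj_of_dist_one hF hu.2 hv' (hx _) (hx _) hu.1 hv.1
  have two {i : ZMod 5} {u v : V} (hu : u ∈ triadSet G c x i)
      (hv : v ∈ triadSet G c x (i + 2)) : G.Adj u v := by
    have e : i + 2 + 1 = i + 3 ∧ i + 2 + 2 = i + 4 ∧ i + 2 + 3 = i ∧ i + 2 + 4 = i + 1 := by
      clear hu hv
      revert i
      decide
    have hv' := hv.2
    rw [e.1, e.2.1, e.2.2.1, e.2.2.2] at hv'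
    exact (hc.hole i).triad_adj_of_dist_two hF hu.2 hv' (hx _) (hx _) (hx _) (hx _) (hx _)
      hu.1 hv.1
  have step : ∀ i j : ZMod 5, i ≠ j → j = i + 1 ∨ j = i + 2 ∨ i = j + 1 ∨ i = j + 2 := by
    decide
  rcases step i j hij with rfl | rfl | rfl | rfl
  · exact one hu hv
  · exact two hu hv
  · exact (one hv hu).symm
  · exact (two hv hu).symm

theorem IsFiveHole.harmonious_triadSet (hF : FFree G) {c : ZMod 5 → V} (hc : IsFiveHole G c)
    {x : V} (hx : ∀ i, ¬ G.Adj x (c i)) : Harmonious G (s := 5) (triadSet G c x) := by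
  refine ⟨fun i j hij => Set.disjoint_left.2 fun v hi hj => ?_, fun i j u v p hu hv hp => ?_,
    fun _ i j hij u hu v hv => hc.triadSet_adj hF hx hij hu hv⟩
  · exact G.irrefl (hc.triadSet_adj hF hx hij hi hj)
  · rcases eq_or_ne i j with rfl | hij
    · refine iff_of_true ?_ rfl
      have huv : ¬ G.Adj u v := (hc.hole i).not_adj_of_triad hF hu.2 hv.2
      have h3 := hp.length_le_three hF
      have hu0 := p.getVert_zero
      have hvl := p.getVert_length
      have : p.length ≠ 1 := fun h1 => huv <| by
        have := hp.adj_getVert_iff (i := 0) (j := 1) (by omega) (by omega)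
        rw [h1] at hvl
        rw [hu0, hvl] at this
        exact this.2 rfl
      have : p.length ≠ 3 := fun hl => by
        rw [hl] at hvl
        have adj {i j : ℕ} (hij : i < j) (hj : j ≤ 3) := hp.adj_getVert_iff hij (hj.trans hl.ge)
        refine (hc.hole i).no_path_of_triad hF hu.2 hv.2 ⟨hx _, hx _, hx _, hx _, hx _⟩ hu.1 hv.1
          (p := p.getVert 1) (q := p.getVert 2) ?_ ?_ ?_ ?_ ?_
        · simpa [hu0] using adj (i := 0) (j := 1)
        · simpa using adj (i := 1) (j := 2)
        · simpa [hvl] using adj (i := 2) (j := 3)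
        · simpa [hu0] using adj (i := 0) (j := 2)
        · simpa [hvl] using adj (i := 1) (j := 3)
      have : p.length = 0 ∨ p.length = 2 := by omega
      rcases this with h | h <;> rw [h] <;> decide
    · refine iff_of_false ?_ hij
      have huv := hc.triadSet_adj hF hx hij hu hv
      have hpos : 0 < p.length := by
        by_contra! h0
        exact huv.ne (p.eq_of_length_eq_zero (by omega))
      have := hp.adj_getVert_iff hpos le_rfl
      rw [p.getVert_zero, p.getVert_length] at this
      rw [this.1 huv]
      decide

theorem IsFiveHole.exists_harmoniousCutset (hF : FFree G) {c : ZMod 5 → V}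
    (hc : IsFiveHole G c) {x : V} (hx : ∀ i, ¬ G.Adj x (c i)) :
    ∃ X : Set V, IsHarmoniousCutset G X := by
  have far {y : V} (hy : ∀ i, ¬ G.Adj y (c i)) : ¬ G.Adj y (c 0) ∧ ¬ G.Adj y (c (0 + 1)) ∧
      ¬ G.Adj y (c (0 + 2)) ∧ ¬ G.Adj y (c (0 + 3)) ∧ ¬ G.Adj y (c (0 + 4)) :=
    ⟨hy _, hy _, hy _, hy _, hy _⟩
  have near {v : V} (hv : ∃ i, G.Adj v (c i)) : ¬ (¬ G.Adj v (c 0) ∧ ¬ G.Adj v (c (0 + 1)) ∧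
      ¬ G.Adj v (c (0 + 2)) ∧ ¬ G.Adj v (c (0 + 3)) ∧ ¬ G.Adj v (c (0 + 4))) := by
    rintro ⟨h0, h1, h2, h3, h4⟩
    obtain ⟨i, hi⟩ := hv
    fin_cases i
    exacts [h0 hi, h1 hi, h2 hi, h3 hi, h4 hi]
  let K : Set V := {y | (∀ i, ¬ G.Adj y (c i)) ∧ ∀ v, (∃ i, G.Adj v (c i)) →
    (G.Adj v y ↔ G.Adj v x)}
  let X : Set V := {v | G.Adj v x ∧ ∃ i, G.Adj v (c i)}
  have hxK : x ∈ K := ⟨hx, fun _ _ => Iff.rfl⟩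
  have hXK {v : V} (hv : v ∈ X) : v ∉ K := fun hK => hv.2.elim hK.1
  have hc0 : G.Adj (c 0) (c 1) := (hc.2 0 1).2 (by decide)
  refine ⟨X, ⟨K ∪ X, Kᶜ, ?_, ⟨x, Or.inl hxK, fun h => h hxK⟩,
    ⟨c 0, fun h => h.1 1 hc0, ?_⟩, ?_, ?_⟩, 5, triadSet G c x, ?_, hc.harmonious_triadSet hF hx⟩
  · ext v
    by_cases hv : v ∈ K <;> simp [hv]
  · rintro (h | h)
    · exact h.1 1 hc0
    · exact hx 0 h.1.symm
  · rintro y ⟨-, hy⟩ w ⟨hwK, hw⟩ hyw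
    have hy : y ∈ K := not_not.1 hy
    by_cases hwc : ∃ i, G.Adj w (c i)
    · exact hw (Or.inr ⟨(hy.2 w hwc).1 hyw.symm, hwc⟩)
    · have hwc : ∀ i, ¬ G.Adj w (c i) := not_exists.1 hwc
      refine hwK ⟨hwc, fun v hv => ?_⟩
      rw [← hy.2 v hv]
      exact ⟨fun h => (hc.hole 0).adj_of_adj hF (far hwc) (far hy.1) (near hv) h hyw.symm,
        fun h => (hc.hole 0).adj_of_adj hF (far hy.1) (far hwc) (near hv) h hyw⟩
  · ext v
    exact ⟨fun h => ⟨Or.inr h, hXK h⟩, fun h => h.1.resolve_left h.2⟩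
  · ext v
    refine Set.mem_iUnion.trans ⟨?_, ?_⟩
    · rintro ⟨i, hi⟩
      exact ⟨hi.1, _, hi.2.1⟩
    · rintro ⟨hvx, hv⟩
      obtain ⟨x1, x2, x3, x4, x5⟩ := far hx
      rcases (hc.hole 0).triad_of_adj hF x1 x2 x3 x4 x5 hvx.symm (near hv) with
        t | t | t | t | t
      exacts [⟨0, hvx, t⟩, ⟨1, hvx, t⟩, ⟨2, hvx, t⟩, ⟨3, hvx, t⟩, ⟨4, hvx, t⟩]

end

/-- **Lemma 13.** In an 𝓕-free graph, either every 5-hole is dominating, or the graph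
contains a harmonious cutset. -/
theorem dominating_or_harmonious_cutset {V : Type} [Fintype V] (G : SimpleGraph V)
    (hF : FFree G) :
    (∀ c : ZMod 5 → V, IsFiveHole G c → ∀ v ∉ Set.range c, ∃ i, G.Adj v (c i)) ∨
    ∃ X : Set V, IsHarmoniousCutset G X := by
  by_cases h : ∀ c : ZMod 5 → V, IsFiveHole G c → ∀ v ∉ Set.range c, ∃ i, G.Adj v (c i)
  · exact Or.inl h
  · push Not at h
    obtain ⟨c, hc, x, -, hx⟩ := h
    exact Or.inr (hc.exists_harmoniousCutset hF hx)
end
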